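/- Let ρ > 2. If f ∈ BMO(ℝⁿ) and the ρ-variation of the heat semigroup V_ρ(W_t)(f)(x) is finite for a.e. x ∈ ℝⁿ, then V_ρ(W_t)(f) ∈ BMO(ℝⁿ) and ‖V_ρ(W_t)(f)‖_{BMO(ℝⁿ)} ≤ C ‖f‖_{BMO(ℝⁿ)} with C independent of f. -/

import Mathlib

open MeasureTheory Filter Set
open scoped ENNReal

noncomputable section

/-- A strictly decreasing sequence of positive reals converging to zero. -/
def NullSeq (t : ℕ → ℝ) : Prop :=
  StrictAnti t ∧ (∀ j, 0 < t j) ∧ Tendsto t atTop (nhds 0)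

/-- The `ρ`-variation seminorm `‖F‖_{E_ρ}`: the supremum, over all strictly decreasing
null sequences `{t_j}`, of `(∑_j |F(t_j) - F(t_{j+1})|^ρ)^{1/ρ}` (valued in `ℝ≥0∞`). -/
def eVar (ρ : ℝ) (F : ℝ → ℝ) : ℝ≥0∞ :=
  ⨆ t : {t : ℕ → ℝ // NullSeq t},
    (∑' j : ℕ, ENNReal.ofReal (|F (t.1 j) - F (t.1 (j + 1))| ^ ρ)) ^ (1 / ρ)

/-- The average of `f` over a set `s` (with respect to Lebesgue measure). -/
def avgOn {n : ℕ} (f : EuclideanSpace ℝ (Fin n) → ℝ) (s : Set (EuclideanSpace ℝ (Fin n))) : ℝ :=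
  ((volume s).toReal)⁻¹ * ∫ y in s, f y

/-- `f` has BMO norm at most `M`: the mean oscillation of `f` over every ball is `≤ M`. -/
def IsBMOWith {n : ℕ} (f : EuclideanSpace ℝ (Fin n) → ℝ) (M : ℝ) : Prop :=
  ∀ (x₀ : EuclideanSpace ℝ (Fin n)) (r : ℝ), 0 < r →
    ((volume (Metric.ball x₀ r)).toReal)⁻¹ *
      ∫ y in Metric.ball x₀ r, |f y - avgOn f (Metric.ball x₀ r)| ≤ M

/-- The classical heat semigroup on `ℝⁿ`:
`W_t(f)(x) = (4πt)^{-n/2} ∫ e^{-|x-y|²/(4t)} f(y) dy`. -/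
def heatOp (n : ℕ) (t : ℝ) (f : EuclideanSpace ℝ (Fin n) → ℝ)
    (x : EuclideanSpace ℝ (Fin n)) : ℝ :=
  (4 * Real.pi * t) ^ (-(n : ℝ) / 2) * ∫ y, Real.exp (-‖x - y‖ ^ 2 / (4 * t)) * f y

section Part1
/-- Greedy count of jumps of size at least `lam` of `v 0, …, v N`, starting from the anchor `a`. -/
def jmp (lam : ℝ) : ℕ → ℝ → (ℕ → ℝ) → ℕ
  | 0, a, v => if lam ≤ |v 0 - a| then 1 else 0
  | N + 1, a, v => if lam ≤ |v 0 - a| then 1 + jmp lam N (v 0) (fun j => v (j + 1))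
      else jmp lam N a (fun j => v (j + 1))

lemma jmp_pos (lam : ℝ) (l : ℕ) : ∀ (N : ℕ) (a : ℝ) (v : ℕ → ℝ), l ≤ N → lam ≤ |v l - a| →
    1 ≤ jmp lam N a v := by
  induction l with
  | zero =>
    intro N a v _ h
    cases N with
    | zero => simp [jmp, h]
    | succ N => simp [jmp, h]
  | succ l ih =>
    intro N a v hl h
    cases N with
    | zero => omega
    | succ N =>
      simp only [jmp]
      split_ifs with h0
      · omega
      · exact ih N a (fun j => v (j + 1)) (by omega) h

lemma jmp_mono_succ (lam : ℝ) (k : ℕ) : ∀ (a : ℝ) (v : ℕ → ℝ), jmp lam k a v ≤ jmp lam (k + 1) a v := by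
  induction k with
  | zero =>
    intro a v
    simp only [jmp]
    split_ifs <;> omega
  | succ k ih =>
    intro a v
    rw [jmp, jmp]
    split_ifs
    · have := ih (v 0) (fun j => v (j + 1))
      omega
    · exact ih a (fun j => v (j + 1))

lemma jmp_mono (lam : ℝ) (a : ℝ) (v : ℕ → ℝ) : Monotone (fun k => jmp lam k a v) :=
  monotone_nat_of_le_succ (fun k => jmp_mono_succ lam k a v)

lemma jmp_inc (lam : ℝ) (hl : 0 < lam) (k : ℕ) : ∀ (l : ℕ) (a : ℝ) (v : ℕ → ℝ), k ≤ l →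
    2 * lam ≤ |v l - v k| → jmp lam k a v + 1 ≤ jmp lam l a v := by
  induction k with
  | zero =>
    intro l a v _ h
    cases l with
    | zero => simp at h; linarith
    | succ l =>
      simp only [jmp]
      split_ifs with h0
      · have := jmp_pos lam l l (v 0) (fun j => v (j + 1)) le_rfl (by linarith)
        omega
      · have := jmp_pos lam l l a (fun j => v (j + 1)) le_rfl (by
          have h1 := abs_sub_le (v (l + 1)) a (v 0)
          rw [abs_sub_comm a] at h1
          simp only [not_le] at h0
          linarith)
        omega
  | succ k ih =>
    intro l a v hkl h
    cases l with
    | zero => omega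
    | succ l =>
      simp only [jmp]
      split_ifs with h0
      · have := ih l (v 0) (fun j => v (j + 1)) (by omega) h
        omega
      · exact ih l a (fun j => v (j + 1)) (by omega) h

lemma jmp_sum (lam : ℝ) (hl : 0 < lam) (a : ℝ) (v : ℕ → ℝ) (σ : ℕ → ℕ) (hσ : Monotone σ) (J : ℕ) :
    (∑ i ∈ Finset.range J, if 2 * lam ≤ |v (σ i) - v (σ (i + 1))| then 1 else 0)
      ≤ jmp lam (σ J) a v := by
  induction J with
  | zero => simp
  | succ J ih =>
    rw [Finset.sum_range_succ]
    split_ifs with h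
    · have := jmp_inc lam hl (σ J) (σ (J + 1)) a v (hσ (Nat.le_succ J)) (by rwa [abs_sub_comm])
      omega
    · have := jmp_mono lam a v (hσ (Nat.le_succ J))
      simp only at this
      simp only [Nat.succ_eq_add_one] at this
      omega

/-- the auxiliary function `min x (x^ρ)` -/
def phi (ρ x : ℝ) : ℝ := min x (x ^ ρ)

lemma phi_nonneg {ρ x : ℝ} (hx : 0 ≤ x) : 0 ≤ phi ρ x := le_min hx (Real.rpow_nonneg hx _)

lemma phi_mono {ρ x y : ℝ} (hρ : 1 ≤ ρ) (hx : 0 ≤ x) (h : x ≤ y) : phi ρ x ≤ phi ρ y :=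
  min_le_min h (Real.rpow_le_rpow hx h (by linarith))

lemma sum_rpow_le {ρ : ℝ} (hρ : 1 ≤ ρ) (J : ℕ) (x : ℕ → ℝ) (hx : ∀ i, 0 ≤ x i) :
    (∑ i ∈ Finset.range J, x i ^ ρ) ^ (1 / ρ) ≤ 1 + ∑ i ∈ Finset.range J, phi ρ (x i) := by
  set S := ∑ i ∈ Finset.range J, phi ρ (x i) with hS
  have hS0 : 0 ≤ S := Finset.sum_nonneg (fun i _ => phi_nonneg (hx i))
  have key : ∑ i ∈ Finset.range J, x i ^ ρ ≤ (1 + S) ^ ρ := by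
    have h1 : ∀ i ∈ Finset.range J, x i ^ ρ ≤ phi ρ (x i) * (1 + S) ^ (ρ - 1) := by
      intro i hi
      rcases le_total (x i) 1 with h | h
      · have : phi ρ (x i) = x i ^ ρ := by
          apply min_eq_right
          simpa using Real.rpow_le_rpow_of_exponent_ge' (hx i) h (by norm_num) hρ
        rw [this]
        have h2 : 1 ≤ (1 + S) ^ (ρ - 1) := Real.one_le_rpow (by linarith) (by linarith)
        exact le_mul_of_one_le_right (Real.rpow_nonneg (hx i) _) h2
      · have : phi ρ (x i) = x i := by
          apply min_eq_left
          simpa using Real.rpow_le_rpow_of_exponent_le h hρ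
        have h3 : x i ≤ S := by
          rw [← this]
          exact Finset.single_le_sum (f := fun i => phi ρ (x i)) (fun i _ => phi_nonneg (hx i)) hi
        rw [this]
        have h4 : x i ^ ρ = x i * x i ^ (ρ - 1) := by
          conv_rhs => rw [← Real.rpow_one_add' (hx i) (by linarith)]
          congr 1; ring
        rw [h4]
        gcongr
        · linarith
    calc _ ≤ ∑ i ∈ Finset.range J, phi ρ (x i) * (1 + S) ^ (ρ - 1) := Finset.sum_le_sum h1
      _ = S * (1 + S) ^ (ρ - 1) := by rw [← Finset.sum_mul]
      _ ≤ (1 + S) * (1 + S) ^ (ρ - 1) := by gcongr; linarith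
      _ = (1 + S) ^ ρ := by
          rw [← Real.rpow_one_add' (by linarith) (by linarith)]; congr 1; ring
  calc _ ≤ ((1 + S) ^ ρ) ^ (1 / ρ) := Real.rpow_le_rpow
        (Finset.sum_nonneg fun i _ => Real.rpow_nonneg (hx i) _) key (by positivity)
    _ = 1 + S := by rw [← Real.rpow_mul (by linarith), mul_one_div_cancel (by linarith), Real.rpow_one]

/-- weights -/
def wt (ρ : ℝ) (m : ℤ) : ℝ≥0∞ := ENNReal.ofReal (phi ρ (2 ^ (m + 2)))

lemma phi_le_tsum {ρ x : ℝ} (hρ : 1 ≤ ρ) (hx : 0 ≤ x) :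
    ENNReal.ofReal (phi ρ x) ≤ ∑' m : ℤ, wt ρ m * (if 2 * (2:ℝ) ^ m ≤ x then 1 else 0) := by
  rcases hx.eq_or_lt with h | h
  · have : phi ρ x ≤ 0 := by rw [← h]; exact min_le_left _ _
    rw [ENNReal.ofReal_of_nonpos this]; exact zero_le
  · obtain ⟨m, hm1, hm2⟩ := exists_mem_Ico_zpow h (y := (2:ℝ)) (by norm_num)
    refine le_trans ?_ (ENNReal.le_tsum (m - 1))
    have e : 2 * (2:ℝ) ^ (m - 1) = 2 ^ m := by
      rw [zpow_sub_one₀ (by norm_num)]; ring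
    rw [e, if_pos hm1, mul_one, wt]
    apply ENNReal.ofReal_le_ofReal
    apply phi_mono hρ hx
    rw [show m - 1 + 2 = m + 1 by ring]; exact hm2.le

lemma path_bound {ρ : ℝ} (hρ : 1 ≤ ρ) (T : ℝ) (hT : 0 < T) (N : ℕ) (v : ℕ → ℝ) (σ : ℕ → ℕ)
    (hσ : Monotone σ) (J : ℕ) (hJ : σ J ≤ N) :
    ENNReal.ofReal ((∑ i ∈ Finset.range J, |v (σ i) - v (σ (i + 1))| ^ ρ) ^ (1 / ρ)) ≤
      ENNReal.ofReal T * (1 + ∑' m : ℤ, wt ρ m * (jmp (T * 2 ^ m) N 0 v : ℝ≥0∞)) := by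
  set x : ℕ → ℝ := fun i => |v (σ i) - v (σ (i + 1))| / T with hx
  have hx0 : ∀ i, 0 ≤ x i := fun i => by positivity
  have h1 : (∑ i ∈ Finset.range J, |v (σ i) - v (σ (i + 1))| ^ ρ) ^ (1 / ρ)
      = T * (∑ i ∈ Finset.range J, x i ^ ρ) ^ (1 / ρ) := by
    have : ∀ i, |v (σ i) - v (σ (i + 1))| ^ ρ = T ^ ρ * x i ^ ρ := by
      intro i
      rw [← Real.mul_rpow hT.le (hx0 i)]
      congr 1; simp only [hx]; field_simp
    simp_rw [this]
    rw [← Finset.mul_sum, Real.mul_rpow (by positivity)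
      (Finset.sum_nonneg fun i _ => Real.rpow_nonneg (hx0 i) _), ← Real.rpow_mul hT.le,
      mul_one_div_cancel (by linarith), Real.rpow_one]
  rw [h1, ENNReal.ofReal_mul hT.le]
  gcongr
  refine (ENNReal.ofReal_le_ofReal (sum_rpow_le hρ J x hx0)).trans ?_
  rw [ENNReal.ofReal_add zero_le_one (Finset.sum_nonneg fun i _ => phi_nonneg (hx0 i)),
    ENNReal.ofReal_one, ENNReal.ofReal_sum_of_nonneg (fun i _ => phi_nonneg (hx0 i))]
  gcongr
  calc ∑ i ∈ Finset.range J, ENNReal.ofReal (phi ρ (x i))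
      ≤ ∑ i ∈ Finset.range J, ∑' m : ℤ, wt ρ m * (if 2 * (2:ℝ) ^ m ≤ x i then 1 else 0) :=
        Finset.sum_le_sum fun i _ => phi_le_tsum hρ (hx0 i)
    _ = ∑' m : ℤ, ∑ i ∈ Finset.range J, wt ρ m * (if 2 * (2:ℝ) ^ m ≤ x i then 1 else 0) := by
        rw [← Summable.tsum_finsetSum]; intros; exact ENNReal.summable
    _ ≤ _ := by
        apply ENNReal.tsum_le_tsum
        intro m
        rw [← Finset.mul_sum]
        gcongr
        have h2 := (jmp_sum (T * 2 ^ m) (by positivity) 0 v σ hσ J).trans (jmp_mono _ 0 v hJ)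
        have h3 : ∀ i, (2 * (2:ℝ) ^ m ≤ x i) ↔ 2 * (T * 2 ^ m) ≤ |v (σ i) - v (σ (i + 1))| := by
          intro i
          simp only [hx]
          rw [le_div_iff₀ hT]
          constructor <;> intro h <;> linarith
        simp_rw [h3]
        exact_mod_cast h2

lemma tsum_wt {ρ : ℝ} (hρ : 2 < ρ) :
    ∃ C : ℝ, 0 < C ∧ ∑' m : ℤ, wt ρ m * ENNReal.ofReal (((2:ℝ) ^ m) ^ 2)⁻¹ ≤ ENNReal.ofReal C := by
  have hs : Summable (fun m : ℤ => phi ρ (2 ^ (m + 2)) * (((2:ℝ) ^ m) ^ 2)⁻¹) := by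
    apply Summable.of_nat_of_neg
    · apply Summable.of_nonneg_of_le (f := fun k : ℕ => 4 * (1/2:ℝ) ^ k)
      · intro k; have := phi_nonneg (ρ := ρ) (x := 2 ^ ((k:ℤ) + 2)) (by positivity); positivity
      · intro k
        calc phi ρ (2 ^ ((k:ℤ) + 2)) * (((2:ℝ) ^ (k:ℤ)) ^ 2)⁻¹ ≤ 2 ^ ((k:ℤ) + 2) * (((2:ℝ) ^ (k:ℤ)) ^ 2)⁻¹ := by
              gcongr; exact min_le_left _ _
          _ = _ := by
              rw [zpow_add₀ (by norm_num)]; simp; field_simp; norm_num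
              
      · exact (summable_geometric_of_lt_one (by norm_num) (by norm_num)).mul_left 4
    · have hq : (2:ℝ) ^ (2 - ρ) < 1 := Real.rpow_lt_one_of_one_lt_of_neg (by norm_num) (by linarith)
      apply Summable.of_nonneg_of_le (f := fun k : ℕ => 4 ^ ρ * ((2:ℝ) ^ (2 - ρ)) ^ k)
      · intro k; have := phi_nonneg (ρ := ρ) (x := 2 ^ (-(k:ℤ) + 2)) (by positivity); positivity
      · intro k
        calc phi ρ (2 ^ (-(k:ℤ) + 2)) * (((2:ℝ) ^ (-(k:ℤ))) ^ 2)⁻¹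
            ≤ (2 ^ (-(k:ℤ) + 2)) ^ ρ * (((2:ℝ) ^ (-(k:ℤ))) ^ 2)⁻¹ := by
              gcongr; exact min_le_right _ _
          _ = 4 ^ ρ * (((2:ℝ) ^ (-(k:ℤ))) ^ ρ * (((2:ℝ) ^ (-(k:ℤ))) ^ 2)⁻¹) := by
              rw [zpow_add₀ (by norm_num), mul_comm, Real.mul_rpow (by positivity) (by positivity)]
              norm_num; ring
          _ = _ := by
              congr 1
              have e : (2:ℝ) ^ (-(k:ℤ)) = 2 ^ (-(k:ℝ)) := by
                rw [← Real.rpow_intCast]; simp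
              rw [e, ← Real.rpow_natCast, ← Real.rpow_natCast, ← Real.rpow_mul (by norm_num),
                ← Real.rpow_mul (by norm_num), ← Real.rpow_mul (by norm_num),
                ← Real.rpow_neg (by norm_num), ← Real.rpow_add (by norm_num)]
              congr 1; push_cast; ring
      · exact (summable_geometric_of_lt_one (by positivity) hq).mul_left _
  refine ⟨∑' m : ℤ, phi ρ (2 ^ (m + 2)) * (((2:ℝ) ^ m) ^ 2)⁻¹ + 1, ?_, ?_⟩
  · have : 0 ≤ ∑' m : ℤ, phi ρ (2 ^ (m + 2)) * (((2:ℝ) ^ m) ^ 2)⁻¹ :=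
      tsum_nonneg fun m => mul_nonneg (phi_nonneg (by positivity)) (by positivity)
    linarith
  · have : ∀ m : ℤ, wt ρ m * ENNReal.ofReal (((2:ℝ) ^ m) ^ 2)⁻¹
        = ENNReal.ofReal (phi ρ (2 ^ (m + 2)) * (((2:ℝ) ^ m) ^ 2)⁻¹) := by
      intro m; rw [wt, ENNReal.ofReal_mul (phi_nonneg (by positivity))]
    simp_rw [this]
    rw [← ENNReal.ofReal_tsum_of_nonneg (fun m => mul_nonneg (phi_nonneg (by positivity)) (by positivity)) hs]
    apply ENNReal.ofReal_le_ofReal; linarith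
end Part1

section Part2
lemma jmp_measurable {Ω : Type*} [MeasurableSpace Ω] (lam : ℝ) (N : ℕ) :
    ∀ (a : Ω → ℝ) (v : ℕ → Ω → ℝ), Measurable a → (∀ j, Measurable (v j)) →
    Measurable (fun ω => jmp lam N (a ω) (fun j => v j ω)) := by
  induction N with
  | zero =>
    intro a v ha hv
    simp only [jmp]
    have h0 := hv 0
    exact Measurable.ite (measurableSet_le (by fun_prop) (by fun_prop)) measurable_const measurable_const
  | succ N ih =>
    intro a v ha hv
    simp only [jmp]
    have h0 := hv 0
    refine Measurable.ite (measurableSet_le (by fun_prop) (by fun_prop)) ?_ ?_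
    · exact (ih (v 0) (fun j => v (j + 1)) h0 (fun j => hv (j + 1))).const_add 1
    · exact ih a (fun j => v (j + 1)) ha (fun j => hv (j + 1))

lemma var_ineq {Ω : Type*} [MeasurableSpace Ω] (μ : Measure Ω) [IsProbabilityMeasure μ] (X : Ω → ℝ)
    (hX : Measurable X) (a : ℝ) :
    ENNReal.ofReal ((∫ ω, X ω ∂μ - a) ^ 2) + ∫⁻ ω, ENNReal.ofReal ((X ω - ∫ ω, X ω ∂μ) ^ 2) ∂μ
      ≤ ∫⁻ ω, ENNReal.ofReal ((X ω - a) ^ 2) ∂μ := by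
  by_cases h : ∫⁻ ω, ENNReal.ofReal ((X ω - a) ^ 2) ∂μ = ⊤
  · rw [h]; exact le_top
  have hi : Integrable (fun ω => (X ω - a) ^ 2) μ := by
    refine ⟨by fun_prop, ?_⟩
    rw [hasFiniteIntegral_iff_ofReal (ae_of_all _ fun ω => sq_nonneg _)]
    exact lt_top_iff_ne_top.2 h
  have h2 : MemLp (fun ω => X ω - a) 2 μ := by
    rw [memLp_two_iff_integrable_sq (by fun_prop)]; exact hi
  have h1 : Integrable (fun ω => X ω - a) μ := h2.integrable (by norm_num)
  have hX1 : Integrable X μ := 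
    (h1.add (integrable_const a)).congr (ae_of_all _ fun ω => by simp)
  set m := ∫ ω, X ω ∂μ with hm
  have hd : ∀ ω, (X ω - m) ^ 2 = (X ω - a) ^ 2 - 2 * (m - a) * (X ω - a) + (m - a) ^ 2 := by
    intro ω; ring
  have hi2 : Integrable (fun ω => (X ω - m) ^ 2) μ := by
    simp_rw [hd]
    exact (hi.sub (h1.const_mul _)).add (integrable_const _)
  rw [← ofReal_integral_eq_lintegral_ofReal hi (ae_of_all _ fun ω => sq_nonneg _),
    ← ofReal_integral_eq_lintegral_ofReal hi2 (ae_of_all _ fun ω => sq_nonneg _),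
    ← ENNReal.ofReal_add (sq_nonneg _) (integral_nonneg fun ω => sq_nonneg _)]
  apply ENNReal.ofReal_le_ofReal
  simp_rw [hd]
  have hs : Integrable (fun ω => (X ω - a) ^ 2 - 2 * (m - a) * (X ω - a)) μ := hi.sub (h1.const_mul _)
  rw [integral_add hs (integrable_const _),
    integral_sub hi (h1.const_mul _), integral_const_mul, integral_sub hX1 (integrable_const _)]
  simp only [integral_const, probReal_univ, smul_eq_mul, one_mul]
  rw [← hm]
  nlinarith

variable {n : ℕ}

/-- convolution powers -/
def cpow (γ : Measure (EuclideanSpace ℝ (Fin n))) : ℕ → Measure (EuclideanSpace ℝ (Fin n))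
  | 0 => Measure.dirac 0
  | k + 1 => Measure.conv γ (cpow γ k)

instance cpow_prob (γ : Measure (EuclideanSpace ℝ (Fin n))) [IsProbabilityMeasure γ] (k : ℕ) :
    IsProbabilityMeasure (cpow γ k) := by
  induction k with
  | zero => rw [cpow]; infer_instance
  | succ k ih => rw [cpow]; infer_instance

/-- the averaging operators -/
def Pop (γ : Measure (EuclideanSpace ℝ (Fin n))) (f : EuclideanSpace ℝ (Fin n) → ℝ) (k : ℕ)
    (y : EuclideanSpace ℝ (Fin n)) : ℝ := ∫ w, f (y + w) ∂(cpow γ k)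

lemma Pop_measurable (γ : Measure (EuclideanSpace ℝ (Fin n))) [IsProbabilityMeasure γ]
    (f : EuclideanSpace ℝ (Fin n) → ℝ) (hf : Measurable f) (k : ℕ) : Measurable (Pop γ f k) := by
  have : StronglyMeasurable (Function.uncurry fun (y w : EuclideanSpace ℝ (Fin n)) => f (y + w)) := by
    apply Measurable.stronglyMeasurable
    exact hf.comp (measurable_fst.add measurable_snd)
  exact (this.integral_prod_right (ν := cpow γ k)).measurable

/-- forward path -/
def Yp (N : ℕ) (y : EuclideanSpace ℝ (Fin n)) (ξ : Fin N → EuclideanSpace ℝ (Fin n)) (j : ℕ) :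
    EuclideanSpace ℝ (Fin n) := y + ∑ i : Fin N, if (i : ℕ) < j then ξ i else 0

/-- backward path -/
def Zp (N : ℕ) (x : EuclideanSpace ℝ (Fin n)) (ξ : Fin N → EuclideanSpace ℝ (Fin n)) (j : ℕ) :
    EuclideanSpace ℝ (Fin n) := x - ∑ i : Fin N, if (i : ℕ) < j then 0 else ξ i

lemma Zp_eq (N : ℕ) (y : EuclideanSpace ℝ (Fin n)) (ξ : Fin N → EuclideanSpace ℝ (Fin n)) (j : ℕ) :
    Zp N (y + ∑ i, ξ i) ξ j = Yp N y ξ j := by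
  unfold Zp Yp
  rw [add_sub_assoc, ← Finset.sum_sub_distrib]
  congr 1
  apply Finset.sum_congr rfl
  intro i _
  split_ifs <;> simp

lemma Yp_cons (N : ℕ) (y w : EuclideanSpace ℝ (Fin n)) (ξ : Fin N → EuclideanSpace ℝ (Fin n)) (j : ℕ) :
    Yp (N + 1) y (Fin.cons w ξ : Fin (N + 1) → EuclideanSpace ℝ (Fin n)) (j + 1) = Yp N (y + w) ξ j := by
  unfold Yp
  rw [Fin.sum_univ_succ]
  simp [add_assoc]

lemma Yp_zero (N : ℕ) (y : EuclideanSpace ℝ (Fin n)) (ξ : Fin N → EuclideanSpace ℝ (Fin n)) :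
    Yp N y ξ 0 = y := by
  simp [Yp]

lemma Yp_measurable (N j : ℕ) :
    Measurable (fun p : EuclideanSpace ℝ (Fin n) × (Fin N → EuclideanSpace ℝ (Fin n)) =>
      Yp N p.1 p.2 j) := by
  unfold Yp
  refine measurable_fst.add (Finset.measurable_sum _ fun i _ => ?_)
  split_ifs <;> fun_prop

lemma Zp_measurable (N j : ℕ) :
    Measurable (fun p : EuclideanSpace ℝ (Fin n) × (Fin N → EuclideanSpace ℝ (Fin n)) =>
      Zp N p.1 p.2 j) := by
  unfold Zp
  refine measurable_fst.sub (Finset.measurable_sum _ fun i _ => ?_)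
  split_ifs <;> fun_prop

lemma lintegral_pi_succ (γ : Measure (EuclideanSpace ℝ (Fin n))) [IsProbabilityMeasure γ] (N : ℕ)
    (F : (Fin (N + 1) → EuclideanSpace ℝ (Fin n)) → ℝ≥0∞) (hF : Measurable F) :
    ∫⁻ ξ, F ξ ∂(Measure.pi fun _ => γ) = ∫⁻ w, ∫⁻ ξ, F (Fin.cons w ξ) ∂(Measure.pi fun _ => γ) ∂γ := by
  have h := (measurePreserving_piFinSuccAbove (fun _ : Fin (N + 1) => γ) 0).symm
  rw [← h.lintegral_comp hF, lintegral_prod]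
  · have hc : ∀ (w : EuclideanSpace ℝ (Fin n)) (ξ : Fin N → EuclideanSpace ℝ (Fin n)),
        (MeasurableEquiv.piFinSuccAbove (fun _ : Fin (N + 1) => EuclideanSpace ℝ (Fin n)) 0).symm (w, ξ)
          = Fin.cons w ξ := by
      intro w ξ
      simp [MeasurableEquiv.piFinSuccAbove]
      rfl
    simp_rw [hc]
  · exact (hF.comp h.measurable).aemeasurable

theorem bellman (γ : Measure (EuclideanSpace ℝ (Fin n))) [IsProbabilityMeasure γ]
    (f : EuclideanSpace ℝ (Fin n) → ℝ) (hf : Measurable f) (lam : ℝ) (hl : 0 < lam) (N : ℕ) :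
    ∀ (y : EuclideanSpace ℝ (Fin n)) (a : ℝ),
    ∫⁻ ξ, ENNReal.ofReal (lam ^ 2) * (jmp lam N a (fun j => Pop γ f (N - j) (Yp N y ξ j)) : ℝ≥0∞)
      ∂(Measure.pi fun _ => γ) ≤ ∫⁻ w, ENNReal.ofReal ((f (y + w) - a) ^ 2) ∂(cpow γ N) := by
  have hP := Pop_measurable γ f hf
  induction N with
  | zero =>
    intro y a
    have hm : Measurable fun w => ENNReal.ofReal ((f (y + w) - a) ^ 2) := by fun_prop
    simp only [cpow, jmp, Yp_zero, lintegral_const, measure_univ, mul_one, lintegral_dirac' _ hm]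
    simp only [Pop, cpow, Nat.sub_zero]
    rw [integral_dirac' _ _ (by apply Measurable.stronglyMeasurable; fun_prop)]
    simp only [add_zero]
    split_ifs with h
    · simp only [Nat.cast_one, mul_one]
      apply ENNReal.ofReal_le_ofReal
      rw [← sq_abs (f y - a)]
      gcongr
    · simp
  | succ N ih =>
    intro y a
    have hmeas : ∀ b : ℝ, Measurable (fun ξ : Fin (N + 1) → EuclideanSpace ℝ (Fin n) =>
        ENNReal.ofReal (lam ^ 2) * (jmp lam (N + 1) b
          (fun j => Pop γ f (N + 1 - j) (Yp (N + 1) y ξ j)) : ℝ≥0∞)) := by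
      intro b
      apply Measurable.const_mul
      apply measurable_from_top.comp
      refine jmp_measurable lam (N + 1) (fun _ => b) (fun j ξ => Pop γ f (N + 1 - j) (Yp (N + 1) y ξ j)) measurable_const ?_
      intro j
      exact (hP _).comp ((Yp_measurable (N + 1) j).comp measurable_prodMk_left)
    rw [lintegral_pi_succ γ N _ (hmeas a)]
    have hstep : ∀ b : ℝ, ∫⁻ w, ∫⁻ ξ, ENNReal.ofReal (lam ^ 2) *
        (jmp lam N b (fun j => Pop γ f (N - j) (Yp N (y + w) ξ j)) : ℝ≥0∞)
          ∂(Measure.pi fun _ => γ) ∂γ ≤ ∫⁻ w, ENNReal.ofReal ((f (y + w) - b) ^ 2) ∂(cpow γ (N + 1)) := by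
      intro b
      rw [cpow, Measure.lintegral_conv (by fun_prop)]
      apply lintegral_mono
      intro w
      simp_rw [← add_assoc]
      exact ih (y + w) b
    simp only [jmp, Yp_zero, Yp_cons, Nat.sub_zero, Nat.reduceSubDiff]
    split_ifs with h
    · simp only [Nat.cast_add, Nat.cast_one, mul_add, mul_one]
      have : ∀ w : EuclideanSpace ℝ (Fin n), ∫⁻ ξ : Fin N → EuclideanSpace ℝ (Fin n), (ENNReal.ofReal (lam ^ 2) + ENNReal.ofReal (lam ^ 2) *
        (jmp lam N (Pop γ f (N + 1) y) (fun j => Pop γ f (N - j) (Yp N (y + w) ξ j)) : ℝ≥0∞))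
          ∂(Measure.pi fun _ => γ) = ENNReal.ofReal (lam ^ 2) + ∫⁻ ξ, ENNReal.ofReal (lam ^ 2) *
        (jmp lam N (Pop γ f (N + 1) y) (fun j => Pop γ f (N - j) (Yp N (y + w) ξ j)) : ℝ≥0∞)
          ∂(Measure.pi fun _ => γ) := by
        intro w
        rw [lintegral_add_left measurable_const]; simp
      simp_rw [this]
      rw [lintegral_add_left measurable_const]
      simp only [lintegral_const, measure_univ, mul_one]
      refine le_trans (add_le_add ?_ (hstep _)) (var_ineq (cpow γ (N + 1)) (fun w => f (y + w)) (by fun_prop) a)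
      apply ENNReal.ofReal_le_ofReal
      rw [← sq_abs (_ - a)]
      gcongr
      exact h
    · exact hstep a

/-- the majorant -/
def majo (ρ T : ℝ) (γ : Measure (EuclideanSpace ℝ (Fin n))) (f : EuclideanSpace ℝ (Fin n) → ℝ)
    (N : ℕ) (x : EuclideanSpace ℝ (Fin n)) : ℝ≥0∞ :=
  ∫⁻ ξ : Fin N → EuclideanSpace ℝ (Fin n), ENNReal.ofReal T * (1 + ∑' m : ℤ, wt ρ m *
    (jmp (T * 2 ^ m) N 0 (fun j => Pop γ f (N - j) (Zp N x ξ j)) : ℝ≥0∞)) ∂(Measure.pi fun _ => γ)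

lemma jmpZ_measurable (γ : Measure (EuclideanSpace ℝ (Fin n))) [IsProbabilityMeasure γ]
    (f : EuclideanSpace ℝ (Fin n) → ℝ) (hf : Measurable f) (N : ℕ) (lam : ℝ) :
    Measurable (fun p : EuclideanSpace ℝ (Fin n) × (Fin N → EuclideanSpace ℝ (Fin n)) =>
      (jmp lam N 0 (fun j => Pop γ f (N - j) (Zp N p.1 p.2 j)) : ℝ≥0∞)) := by
  apply measurable_from_top.comp
  refine jmp_measurable lam N (fun _ => 0) (fun j (p : EuclideanSpace ℝ (Fin n) × (Fin N → EuclideanSpace ℝ (Fin n))) => Pop γ f (N - j) (Zp N p.1 p.2 j)) measurable_const ?_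
  intro j
  exact (Pop_measurable γ f hf _).comp (Zp_measurable N j)

lemma majo_measurable (ρ T : ℝ) (γ : Measure (EuclideanSpace ℝ (Fin n))) [IsProbabilityMeasure γ]
    (f : EuclideanSpace ℝ (Fin n) → ℝ) (hf : Measurable f) (N : ℕ) : Measurable (majo ρ T γ f N) := by
  have : Measurable (Function.uncurry fun (x : EuclideanSpace ℝ (Fin n)) (ξ : Fin N → EuclideanSpace ℝ (Fin n)) =>
    ENNReal.ofReal T * (1 + ∑' m : ℤ, wt ρ m *
    (jmp (T * 2 ^ m) N 0 (fun j => Pop γ f (N - j) (Zp N x ξ j)) : ℝ≥0∞))) := by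
    refine (Measurable.const_add ?_ _).const_mul _
    refine Measurable.tsum fun m => ?_
    exact (jmpZ_measurable γ f hf N _).const_mul _
  exact this.lintegral_prod_right

lemma lintegral_shift {N : ℕ} (γ : Measure (EuclideanSpace ℝ (Fin n))) [IsProbabilityMeasure γ]
    (H : EuclideanSpace ℝ (Fin n) × (Fin N → EuclideanSpace ℝ (Fin n)) → ℝ≥0∞) (hH : Measurable H) :
    ∫⁻ x, ∫⁻ ξ, H (x, ξ) ∂(Measure.pi fun _ => γ)
      = ∫⁻ y, ∫⁻ ξ, H (y + ∑ i, ξ i, ξ) ∂(Measure.pi fun _ => γ) := by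
  have hy : Measurable (fun p : EuclideanSpace ℝ (Fin n) × (Fin N → EuclideanSpace ℝ (Fin n)) =>
      H (p.1 + ∑ i, p.2 i, p.2)) := by
    refine hH.comp (Measurable.prodMk (measurable_fst.add ?_) measurable_snd)
    exact Finset.measurable_sum _ fun i _ => (measurable_pi_apply i).comp measurable_snd
  have e1 := lintegral_lintegral_swap (μ := (volume : Measure (EuclideanSpace ℝ (Fin n))))
    (ν := Measure.pi fun _ : Fin N => γ) (f := fun x ξ => H (x, ξ)) hH.aemeasurable
  have e2 := lintegral_lintegral_swap (μ := (volume : Measure (EuclideanSpace ℝ (Fin n))))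
    (ν := Measure.pi fun _ : Fin N => γ) (f := fun x ξ => H (x + ∑ i, ξ i, ξ)) hy.aemeasurable
  rw [e1, e2]
  apply lintegral_congr
  intro ξ
  exact (lintegral_add_right_eq_self (μ := (volume : Measure (EuclideanSpace ℝ (Fin n))))
    (fun x => H (x, ξ)) (∑ i, ξ i)).symm

lemma jmpZ_total (γ : Measure (EuclideanSpace ℝ (Fin n))) [IsProbabilityMeasure γ]
    (f : EuclideanSpace ℝ (Fin n) → ℝ) (hf : Measurable f) (N : ℕ) (lam : ℝ) (hl : 0 < lam) :
    ∫⁻ x, ∫⁻ ξ : Fin N → EuclideanSpace ℝ (Fin n),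
      (jmp lam N 0 (fun j => Pop γ f (N - j) (Zp N x ξ j)) : ℝ≥0∞) ∂(Measure.pi fun _ => γ)
      ≤ ENNReal.ofReal (lam ^ 2)⁻¹ * ∫⁻ x, ENNReal.ofReal (f x ^ 2) := by
  have hz := jmpZ_measurable γ f hf N lam
  have e1 : ∫⁻ x, ∫⁻ ξ : Fin N → EuclideanSpace ℝ (Fin n),
      (jmp lam N 0 (fun j => Pop γ f (N - j) (Zp N x ξ j)) : ℝ≥0∞) ∂(Measure.pi fun _ => γ)
      = ∫⁻ y, ∫⁻ ξ : Fin N → EuclideanSpace ℝ (Fin n),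
      (jmp lam N 0 (fun j => Pop γ f (N - j) (Yp N y ξ j)) : ℝ≥0∞) ∂(Measure.pi fun _ => γ) := by
    have hy := lintegral_shift (N := N) γ _ hz
    simp only [Zp_eq] at hy
    exact hy
  rw [e1]
  have hB := bellman γ f hf lam hl N
  have h2 : ∀ y, ∫⁻ ξ : Fin N → EuclideanSpace ℝ (Fin n),
      (jmp lam N 0 (fun j => Pop γ f (N - j) (Yp N y ξ j)) : ℝ≥0∞) ∂(Measure.pi fun _ => γ) ≤
      ENNReal.ofReal (lam ^ 2)⁻¹ * ∫⁻ w, ENNReal.ofReal (f (y + w) ^ 2) ∂(cpow γ N) := by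
    intro y
    have h3 := hB y 0
    rw [lintegral_const_mul' _ _ ENNReal.ofReal_ne_top] at h3
    simp only [sub_zero] at h3
    calc _ = ENNReal.ofReal (lam ^ 2)⁻¹ * (ENNReal.ofReal (lam ^ 2) * _) := by
          rw [← mul_assoc, ← ENNReal.ofReal_mul (by positivity), inv_mul_cancel₀ (by positivity), ENNReal.ofReal_one, one_mul]
      _ ≤ _ := by gcongr
  refine (lintegral_mono h2).trans ?_
  rw [lintegral_const_mul' _ _ ENNReal.ofReal_ne_top]
  refine mul_le_mul' le_rfl ?_
  rw [lintegral_lintegral_swap (by fun_prop)]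
  apply le_of_eq
  calc _ = ∫⁻ w : EuclideanSpace ℝ (Fin n), (∫⁻ x, ENNReal.ofReal (f x ^ 2)) ∂(cpow γ N) := by
        apply lintegral_congr
        intro w
        exact lintegral_add_right_eq_self (μ := (volume : Measure (EuclideanSpace ℝ (Fin n)))) (fun x => ENNReal.ofReal (f x ^ 2)) w
    _ = _ := by simp

lemma majo_integral {ρ C : ℝ} (hC : ∑' m : ℤ, wt ρ m * ENNReal.ofReal (((2:ℝ) ^ m) ^ 2)⁻¹ ≤ ENNReal.ofReal C)
    (T : ℝ) (hT : 0 < T) (γ : Measure (EuclideanSpace ℝ (Fin n))) [IsProbabilityMeasure γ]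
    (f : EuclideanSpace ℝ (Fin n) → ℝ) (hf : Measurable f) (N : ℕ) (B : Set (EuclideanSpace ℝ (Fin n))) :
    ∫⁻ x in B, majo ρ T γ f N x ≤ ENNReal.ofReal T * (volume B +
      ENNReal.ofReal C * (ENNReal.ofReal (T ^ 2)⁻¹ * ∫⁻ x, ENNReal.ofReal (f x ^ 2))) := by
  have hz := jmpZ_measurable γ f hf N
  have hz2 : ∀ m : ℤ, ∀ x, Measurable fun ξ : Fin N → EuclideanSpace ℝ (Fin n) =>
      wt ρ m * (jmp (T * 2 ^ m) N 0 (fun j => Pop γ f (N - j) (Zp N x ξ j)) : ℝ≥0∞) := by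
    intro m x
    exact ((hz (T * 2 ^ m)).comp measurable_prodMk_left).const_mul _
  have e : ∀ x, majo ρ T γ f N x = ENNReal.ofReal T * (1 + ∑' m : ℤ, wt ρ m *
      ∫⁻ ξ : Fin N → EuclideanSpace ℝ (Fin n),
      (jmp (T * 2 ^ m) N 0 (fun j => Pop γ f (N - j) (Zp N x ξ j)) : ℝ≥0∞) ∂(Measure.pi fun _ => γ)) := by
    intro x
    unfold majo
    rw [lintegral_const_mul' _ _ ENNReal.ofReal_ne_top, lintegral_add_left measurable_const,
      lintegral_tsum (fun m => (hz2 m x).aemeasurable)]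
    simp only [lintegral_const, measure_univ, mul_one]
    congr 3
    ext m
    rw [lintegral_const_mul' _ _ (by unfold wt; exact ENNReal.ofReal_ne_top)]
  simp_rw [e]
  rw [lintegral_const_mul' _ _ ENNReal.ofReal_ne_top, lintegral_add_left measurable_const]
  have hz3 : ∀ m : ℤ, Measurable fun x => wt ρ m * ∫⁻ ξ : Fin N → EuclideanSpace ℝ (Fin n),
      (jmp (T * 2 ^ m) N 0 (fun j => Pop γ f (N - j) (Zp N x ξ j)) : ℝ≥0∞) ∂(Measure.pi fun _ => γ) := by
    intro m
    exact Measurable.const_mul ((hz (T * 2 ^ m)).lintegral_prod_right') _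
  rw [lintegral_tsum (fun m => (hz3 m).aemeasurable)]
  simp only [lintegral_const, Measure.restrict_apply MeasurableSet.univ, univ_inter, one_mul]
  gcongr
  calc _ ≤ ∑' m : ℤ, wt ρ m * (ENNReal.ofReal ((T * 2 ^ m) ^ 2)⁻¹ * ∫⁻ x, ENNReal.ofReal (f x ^ 2)) := by
        apply ENNReal.tsum_le_tsum
        intro m
        rw [lintegral_const_mul' _ _ (by unfold wt; exact ENNReal.ofReal_ne_top)]
        gcongr
        refine le_trans (setLIntegral_le_lintegral _ _) ?_
        exact jmpZ_total γ f hf N _ (by positivity)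
    _ = (∑' m : ℤ, wt ρ m * ENNReal.ofReal (((2:ℝ) ^ m) ^ 2)⁻¹) * (ENNReal.ofReal (T ^ 2)⁻¹ * ∫⁻ x, ENNReal.ofReal (f x ^ 2)) := by
        rw [← ENNReal.tsum_mul_right]
        congr 1
        ext m
        rw [mul_pow, mul_inv, ENNReal.ofReal_mul (by positivity)]
        ring
    _ ≤ _ := by gcongr
end Part2

section Part3
lemma minkowski_integral {Ω : Type*} [MeasurableSpace Ω] (μ : Measure Ω) {ρ : ℝ} (hρ : 1 ≤ ρ) (J : ℕ)
    (X : ℕ → Ω → ℝ) (hX : ∀ i ∈ Finset.range J, Integrable (X i) μ) :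
    ENNReal.ofReal ((∑ i ∈ Finset.range J, |∫ ω, X i ω ∂μ| ^ ρ) ^ (1 / ρ)) ≤
      ∫⁻ ω, ENNReal.ofReal ((∑ i ∈ Finset.range J, |X i ω| ^ ρ) ^ (1 / ρ)) ∂μ := by
  set p : ℝ≥0∞ := ENNReal.ofReal ρ with hp
  have : Fact (1 ≤ p) := ⟨by rw [hp]; simpa using hρ⟩
  have hpr : p.toReal = ρ := ENNReal.toReal_ofReal (by linarith)
  let V : Ω → PiLp p (fun _ : Fin J => ℝ) := fun ω => WithLp.toLp p (fun i => X i ω)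
  have hn : ∀ w : Fin J → ℝ, ‖(WithLp.toLp p w : PiLp p (fun _ : Fin J => ℝ))‖ = (∑ i, |w i| ^ ρ) ^ (1 / ρ) := by
    intro w
    rw [PiLp.norm_eq_sum (by rw [hpr]; linarith), hpr]
    simp
  have hV : Integrable V μ := by
    have h1 : Integrable (fun ω => (fun i : Fin J => X i ω)) μ :=
      Integrable.of_eval (fun i => hX i (by simp))
    exact (PiLp.continuousLinearEquiv p ℝ (fun _ : Fin J => ℝ)).symm.toContinuousLinearMap.integrable_comp h1
  have hVi : ∫ ω, V ω ∂μ = WithLp.toLp p (fun i : Fin J => ∫ ω, X i ω ∂μ) := by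
    ext i
    have := (PiLp.proj p (𝕜 := ℝ) (fun _ : Fin J => ℝ) i).integral_comp_comm hV
    exact this.symm
  have h := enorm_integral_le_lintegral_enorm (μ := μ) V
  rw [hVi] at h
  simp_rw [← ofReal_norm, V, hn] at h
  simp_rw [Finset.sum_range]
  exact h

variable {n : ℕ}

lemma map_sum_cpow (γ : Measure (EuclideanSpace ℝ (Fin n))) [IsProbabilityMeasure γ] (N : ℕ)
    (s : Finset (Fin N)) :
    (Measure.pi fun _ : Fin N => γ).map (fun ξ => ∑ i ∈ s, ξ i) = cpow γ s.card := by
  classical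
  induction s using Finset.induction_on with
  | empty =>
    simp [cpow, Measure.map_const]
  | insert i s hi ih =>
    rw [Finset.card_insert_of_notMem hi, cpow, ← ih]
    have hind := ProbabilityTheory.iIndepFun_pi (μ := fun _ : Fin N => γ) (X := fun _ x => x)
      (fun i => aemeasurable_id)
    have h2 := (hind.indepFun_finsetSum_of_notMem (fun i => measurable_pi_apply i) hi).symm
    have h3 := h2.map_add_eq_map_conv_map (measurable_pi_apply i)
      (by rw [Finset.sum_fn]; exact Finset.measurable_sum s (fun j _ => measurable_pi_apply j))
    rw [show (fun ξ : Fin N → EuclideanSpace ℝ (Fin n) => ∑ i ∈ insert i s, ξ i)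
      = (fun ω => ω i) + ∑ j ∈ s, fun ω => ω j by ext1 ξ; simp [Finset.sum_insert hi], h3]
    congr 1
    · exact (measurePreserving_eval (fun _ : Fin N => γ) i).map_eq
    · congr 1; ext1 ξ; simp

lemma Zp_law (γ : Measure (EuclideanSpace ℝ (Fin n))) [IsProbabilityMeasure γ] (N k : ℕ) (hk : k ≤ N)
    (x : EuclideanSpace ℝ (Fin n)) (hs : (cpow γ k).map (fun w => -w) = cpow γ k) :
    (Measure.pi fun _ : Fin N => γ).map (fun ξ => Zp N x ξ (N - k)) = (cpow γ k).map (fun w => x + w) := by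
  have hc : (Finset.univ.filter (fun i : Fin N => ¬ ((i : ℕ) < N - k))).card = k := by
    have h1 := Finset.card_filter_add_card_filter_not (s := (Finset.univ : Finset (Fin N))) (fun i : Fin N => (i : ℕ) < N - k)
    rw [Fin.card_filter_val_lt, Finset.card_univ, Fintype.card_fin] at h1
    omega
  have h := map_sum_cpow γ N (Finset.univ.filter (fun i : Fin N => ¬ ((i : ℕ) < N - k)))
  rw [hc] at h
  rw [← hs, ← h, Measure.map_map (by fun_prop) (by fun_prop), Measure.map_map (by fun_prop) (by fun_prop)]
  congr 1
  ext1 ξ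
  simp only [Zp, Function.comp, Finset.sum_filter, ite_not, sub_eq_add_neg]

lemma Zp_mean (γ : Measure (EuclideanSpace ℝ (Fin n))) [IsProbabilityMeasure γ] (N k : ℕ) (hk : k ≤ N)
    (x : EuclideanSpace ℝ (Fin n)) (hs : (cpow γ k).map (fun w => -w) = cpow γ k)
    (f : EuclideanSpace ℝ (Fin n) → ℝ) (hf : Measurable f)
    (hi : Integrable (fun w => f (x + w)) (Measure.conv (cpow γ k) (cpow γ k))) :
    Integrable (fun ξ : Fin N → EuclideanSpace ℝ (Fin n) => Pop γ f k (Zp N x ξ (N - k))) (Measure.pi fun _ => γ) ∧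
    ∫ ξ : Fin N → EuclideanSpace ℝ (Fin n), Pop γ f k (Zp N x ξ (N - k)) ∂(Measure.pi fun _ => γ)
      = ∫ w, f (x + w) ∂(Measure.conv (cpow γ k) (cpow γ k)) := by
  have hP := Pop_measurable γ f hf k
  have hZ : Measurable (fun ξ : Fin N → EuclideanSpace ℝ (Fin n) => Zp N x ξ (N - k)) :=
    (Zp_measurable N (N - k)).comp measurable_prodMk_left
  have hfx : Measurable (fun w => f (x + w)) := by fun_prop
  have hi2 : Integrable (fun p : EuclideanSpace ℝ (Fin n) × EuclideanSpace ℝ (Fin n) => f (x + p.1 + p.2))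
      ((cpow γ k).prod (cpow γ k)) := by
    have := hi
    unfold Measure.conv at this
    have := (integrable_map_measure hfx.aestronglyMeasurable (by fun_prop)).1 this
    simpa [Function.comp_def, add_assoc] using this
  have hl := Zp_law γ N k hk x hs
  constructor
  · have : Integrable (Pop γ f k) ((Measure.pi fun _ : Fin N => γ).map (fun ξ => Zp N x ξ (N - k))) := by
      rw [hl]
      rw [integrable_map_measure (hP.aestronglyMeasurable) (by fun_prop)]
      exact hi2.integral_prod_left
    exact (integrable_map_measure (hP.aestronglyMeasurable) hZ.aemeasurable).1 this
  · rw [← integral_map (f := Pop γ f k) hZ.aemeasurable hP.aestronglyMeasurable, hl,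
      integral_map (by fun_prop) hP.aestronglyMeasurable]
    unfold Measure.conv
    rw [integral_map (by fun_prop) hfx.aestronglyMeasurable]
    simp_rw [← add_assoc]
    rw [integral_prod _ hi2]
    rfl

lemma majo_lower {ρ : ℝ} (hρ : 1 ≤ ρ) (T : ℝ) (hT : 0 < T)
    (γ : Measure (EuclideanSpace ℝ (Fin n))) [IsProbabilityMeasure γ] (N : ℕ)
    (x : EuclideanSpace ℝ (Fin n)) (hs : ∀ k, 1 ≤ k → (cpow γ k).map (fun w => -w) = cpow γ k)
    (f : EuclideanSpace ℝ (Fin n) → ℝ) (hf : Measurable f)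
    (hi : ∀ k, 1 ≤ k → Integrable (fun w => f (x + w)) (Measure.conv (cpow γ k) (cpow γ k)))
    (J : ℕ) (κ : ℕ → ℕ) (hκ : Antitone κ) (h1 : ∀ i, i ≤ J → 1 ≤ κ i) (hN : κ 0 ≤ N) :
    ENNReal.ofReal ((∑ i ∈ Finset.range J,
      |∫ w, f (x + w) ∂(Measure.conv (cpow γ (κ i)) (cpow γ (κ i)))
        - ∫ w, f (x + w) ∂(Measure.conv (cpow γ (κ (i + 1))) (cpow γ (κ (i + 1))))| ^ ρ) ^ (1 / ρ))
      ≤ majo ρ T γ f N x := by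
  have hκN : ∀ i, κ i ≤ N := fun i => (hκ (Nat.zero_le i)).trans hN
  have hm : ∀ i, i ≤ J → _ := fun i hiJ => Zp_mean γ N (κ i) (hκN i) x (hs _ (h1 i hiJ)) f hf (hi _ (h1 i hiJ))
  have hmink := minkowski_integral (Measure.pi fun _ : Fin N => γ) hρ J
    (fun i ξ => Pop γ f (κ i) (Zp N x ξ (N - κ i)) - Pop γ f (κ (i + 1)) (Zp N x ξ (N - κ (i + 1))))
    (fun i hiJ => (hm i (Finset.mem_range.1 hiJ).le).1.sub (hm (i + 1) (Finset.mem_range.1 hiJ)).1)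
  have e : ∑ i ∈ Finset.range J,
      |∫ w, f (x + w) ∂(Measure.conv (cpow γ (κ i)) (cpow γ (κ i)))
        - ∫ w, f (x + w) ∂(Measure.conv (cpow γ (κ (i + 1))) (cpow γ (κ (i + 1))))| ^ ρ
      = ∑ i ∈ Finset.range J, |∫ ξ : Fin N → EuclideanSpace ℝ (Fin n), (Pop γ f (κ i) (Zp N x ξ (N - κ i)) - Pop γ f (κ (i + 1)) (Zp N x ξ (N - κ (i + 1)))) ∂(Measure.pi fun _ => γ)| ^ ρ := by
    apply Finset.sum_congr rfl
    intro i hiJ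
    rw [integral_sub (hm i (Finset.mem_range.1 hiJ).le).1 (hm (i + 1) (Finset.mem_range.1 hiJ)).1,
      (hm i (Finset.mem_range.1 hiJ).le).2, (hm (i + 1) (Finset.mem_range.1 hiJ)).2]
  rw [e]
  refine hmink.trans ?_
  unfold majo
  apply lintegral_mono
  intro ξ
  have hpb := path_bound hρ T hT N (fun j => Pop γ f (N - j) (Zp N x ξ j)) (fun i => N - κ i)
    (fun i j hij => Nat.sub_le_sub_left (hκ hij) N) J (Nat.sub_le _ _)
  simp only [Nat.sub_sub_self (hκN _)] at hpb
  exact hpb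
end Part3

section Part4
/-- heat kernel -/
def hker (n : ℕ) (t : ℝ) (z : EuclideanSpace ℝ (Fin n)) : ℝ :=
  (4 * Real.pi * t) ^ (-(n : ℝ) / 2) * Real.exp (-‖z‖ ^ 2 / (4 * t))

/-- Gaussian measure -/
def gam (n : ℕ) (t : ℝ) : Measure (EuclideanSpace ℝ (Fin n)) :=
  volume.withDensity (fun z => ENNReal.ofReal (hker n t z))

variable {n : ℕ}

lemma hker_nonneg {t : ℝ} (ht : 0 < t) (z : EuclideanSpace ℝ (Fin n)) : 0 ≤ hker n t z := by
  unfold hker; positivity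

lemma hker_cont (t : ℝ) : Continuous (hker n t) := by
  unfold hker; fun_prop

lemma hker_integral {t : ℝ} (ht : 0 < t) : Integrable (hker n t) ∧ ∫ z, hker n t z = 1 := by
  have h := GaussianFourier.integral_rexp_neg_mul_sq_norm (V := EuclideanSpace ℝ (Fin n)) (b := 1 / (4 * t)) (by positivity)
  have e : ∀ z : EuclideanSpace ℝ (Fin n), hker n t z = (4 * Real.pi * t) ^ (-(n : ℝ) / 2) * Real.exp (-(1 / (4 * t)) * ‖z‖ ^ 2) := by
    intro z; unfold hker; congr 2; ring
  have h1 : ∫ z, hker n t z = 1 := by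
    simp_rw [e]
    rw [integral_const_mul, h, finrank_euclideanSpace_fin]
    rw [show Real.pi / (1 / (4 * t)) = 4 * Real.pi * t by field_simp, ← Real.rpow_add (by positivity)]
    rw [show -(n:ℝ) / 2 + n / 2 = 0 by ring, Real.rpow_zero]
  refine ⟨?_, h1⟩
  by_contra hc
  rw [integral_undef hc] at h1
  norm_num at h1

lemma gam_prob {t : ℝ} (ht : 0 < t) : IsProbabilityMeasure (gam n t) := by
  constructor
  unfold gam
  rw [withDensity_apply _ MeasurableSet.univ, Measure.restrict_univ,
    ← ofReal_integral_eq_lintegral_ofReal (hker_integral ht).1 (ae_of_all _ (hker_nonneg ht)),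
    (hker_integral ht).2, ENNReal.ofReal_one]

lemma integral_gam {F : Type*} [NormedAddCommGroup F] [NormedSpace ℝ F] {t : ℝ} (ht : 0 < t)
    (g : EuclideanSpace ℝ (Fin n) → F) : ∫ z, g z ∂(gam n t) = ∫ z, hker n t z • g z := by
  unfold gam
  rw [integral_withDensity_eq_integral_toReal_smul
    ((hker_cont t).measurable.ennreal_ofReal) (ae_of_all _ fun z => ENNReal.ofReal_lt_top)]
  simp_rw [ENNReal.toReal_ofReal (hker_nonneg ht _)]

lemma charFun_gam {t : ℝ} (ht : 0 < t) (ξ : EuclideanSpace ℝ (Fin n)) :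
    charFun (gam n t) ξ = Complex.exp (-t * ‖ξ‖ ^ 2) := by
  have hp := gam_prob (n := n) ht
  have key : ∀ ξ, charFun (gam n t) ξ = ((4 * Real.pi * t) ^ (-(n : ℝ) / 2) : ℝ) *
      ((Real.pi / ((1 / (4 * t) : ℝ) : ℂ)) ^ (Module.finrank ℝ (EuclideanSpace ℝ (Fin n)) / 2 : ℂ)
        * Complex.exp (-t * ‖ξ‖ ^ 2)) := by
    intro ξ
    have h := GaussianFourier.integral_cexp_neg_mul_sq_norm_add (V := EuclideanSpace ℝ (Fin n))
      (b := ((1 / (4 * t) : ℝ) : ℂ)) (by rw [Complex.ofReal_re]; positivity) Complex.I ξ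
    have ht' : (t : ℂ) ≠ 0 := by exact_mod_cast ht.ne'
    rw [show Complex.I ^ 2 * ‖ξ‖ ^ 2 / (4 * ((1 / (4 * t) : ℝ) : ℂ)) = -t * ‖ξ‖ ^ 2 by
      rw [Complex.I_sq]; push_cast; field_simp] at h
    rw [← h, charFun_apply, integral_gam ht, ← integral_const_mul]
    congr 1
    ext z
    rw [hker, Complex.real_smul, Complex.ofReal_mul, mul_assoc, Complex.ofReal_exp, ← Complex.exp_add]
    congr 2
    rw [real_inner_comm]
    push_cast
    ring
  have h0 := key 0
  rw [charFun_zero, probReal_univ] at h0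
  simp only [norm_zero, Complex.ofReal_zero, ne_eq, OfNat.ofNat_ne_zero, not_false_eq_true, zero_pow,
    mul_zero, Complex.exp_zero, mul_one, Complex.ofReal_one] at h0
  rw [key ξ, ← mul_assoc, ← h0, one_mul]

lemma gam_conv {s t : ℝ} (hs : 0 < s) (ht : 0 < t) : Measure.conv (gam n s) (gam n t) = gam n (s + t) := by
  have := gam_prob (n := n) hs
  have := gam_prob (n := n) ht
  have := gam_prob (n := n) (add_pos hs ht)
  apply Measure.ext_of_charFun
  ext ξ
  rw [charFun_conv, charFun_gam hs, charFun_gam ht, charFun_gam (add_pos hs ht), ← Complex.exp_add]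
  congr 1
  push_cast; ring

lemma gam_neg (t : ℝ) : (gam n t).map (fun w => -w) = gam n t := by
  ext s hs
  rw [Measure.map_apply measurable_neg hs]
  unfold gam
  rw [withDensity_apply _ (measurable_neg hs), withDensity_apply _ hs,
    ← lintegral_indicator hs, ← lintegral_indicator (measurable_neg hs),
    ← lintegral_neg_eq_self (μ := (volume : Measure (EuclideanSpace ℝ (Fin n))))]
  apply lintegral_congr
  intro z
  have e : (-z ∈ (fun w : EuclideanSpace ℝ (Fin n) => -w) ⁻¹' s) ↔ z ∈ s := by simp
  have e2 : hker n t (-z) = hker n t z := by simp [hker]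
  by_cases hz : z ∈ s
  · rw [indicator_of_mem (e.2 hz), indicator_of_mem hz, e2]
  · rw [indicator_of_notMem (fun h => hz (e.1 h)), indicator_of_notMem hz]

lemma cpow_gam {δ : ℝ} (hδ : 0 < δ) (k : ℕ) : cpow (gam n δ) (k + 1) = gam n ((k + 1 : ℕ) * δ) := by
  have := gam_prob (n := n) hδ
  induction k with
  | zero => simp [cpow]
  | succ k ih =>
    rw [cpow, ih, gam_conv hδ (by positivity)]
    congr 1; push_cast; ring

lemma heatOp_eq {t : ℝ} (ht : 0 < t) (f : EuclideanSpace ℝ (Fin n) → ℝ) (x : EuclideanSpace ℝ (Fin n)) :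
    heatOp n t f x = ∫ w, f (x + w) ∂(gam n t) := by
  rw [integral_gam ht, heatOp, ← integral_const_mul,
    ← integral_add_left_eq_self (μ := (volume : Measure (EuclideanSpace ℝ (Fin n)))) _ x]
  congr 1
  ext w
  simp [hker, mul_assoc]

lemma heat_integrable {t : ℝ} (ht : 0 < t) (f : EuclideanSpace ℝ (Fin n) → ℝ) (hf : Integrable f)
    (x : EuclideanSpace ℝ (Fin n)) : Integrable (fun w => f (x + w)) (gam n t) := by
  unfold gam
  rw [integrable_withDensity_iff_integrable_smul' ((hker_cont t).measurable.ennreal_ofReal)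
    (ae_of_all _ fun z => ENNReal.ofReal_lt_top)]
  simp_rw [ENNReal.toReal_ofReal (hker_nonneg ht _), smul_eq_mul]
  apply (hf.comp_add_left x).bdd_mul (c := (4 * Real.pi * t) ^ (-(n : ℝ) / 2))
    (hker_cont t).aestronglyMeasurable
  refine ae_of_all _ fun z => ?_
  rw [Real.norm_of_nonneg (hker_nonneg ht z)]
  unfold hker
  apply mul_le_of_le_one_right (by positivity)
  rw [Real.exp_le_one_iff]
  exact div_nonpos_of_nonpos_of_nonneg (by simp) (by positivity)

lemma heat_cont (f : EuclideanSpace ℝ (Fin n) → ℝ) (hf : Integrable f)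
    (x : EuclideanSpace ℝ (Fin n)) : ContinuousOn (fun t => heatOp n t f x) (Ioi 0) := by
  unfold heatOp
  apply ContinuousOn.mul
  · apply ContinuousOn.rpow_const (by fun_prop)
    intro t ht
    left
    have : 0 < t := ht
    positivity
  · apply continuousOn_of_dominated (bound := fun y => ‖f y‖)
    · intro t ht
      exact (Continuous.aestronglyMeasurable (by fun_prop)).mul hf.1
    · intro t ht
      refine ae_of_all _ fun y => ?_
      rw [norm_mul]
      apply mul_le_of_le_one_left (norm_nonneg _)
      rw [Real.norm_of_nonneg (Real.exp_pos _).le, Real.exp_le_one_iff]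
      have : 0 < t := ht
      exact div_nonpos_of_nonpos_of_nonneg (by simp) (by positivity)
    · exact hf.norm
    · refine ae_of_all _ fun y => ?_
      apply ContinuousOn.mul _ continuousOn_const
      apply ContinuousOn.rexp
      apply ContinuousOn.div continuousOn_const (by fun_prop)
      intro t ht
      have : 0 < t := ht
      positivity

lemma dyadic_lower {ρ : ℝ} (hρ : 1 ≤ ρ) (T : ℝ) (hT : 0 < T) (f : EuclideanSpace ℝ (Fin n) → ℝ)
    (hfm : Measurable f) (hf : Integrable f) (x : EuclideanSpace ℝ (Fin n)) (m N J : ℕ)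
    (κ : ℕ → ℕ) (hκ : Antitone κ) (h1 : ∀ i, i ≤ J → 1 ≤ κ i) (hN : κ 0 ≤ N) :
    ENNReal.ofReal ((∑ i ∈ Finset.range J,
      |heatOp n (κ i / 2 ^ m) f x - heatOp n (κ (i + 1) / 2 ^ m) f x| ^ ρ) ^ (1 / ρ))
      ≤ majo ρ T (gam n (1 / 2 ^ (m + 1))) f N x := by
  have hδ : (0:ℝ) < 1 / 2 ^ (m + 1) := by positivity
  have := gam_prob (n := n) hδ
  have hc : ∀ k : ℕ, 1 ≤ k → Measure.conv (cpow (gam n (1 / 2 ^ (m + 1))) k) (cpow (gam n (1 / 2 ^ (m + 1))) k)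
      = gam n (k / 2 ^ m) := by
    intro k hk
    obtain ⟨k, rfl⟩ : ∃ l, k = l + 1 := ⟨k - 1, by omega⟩
    rw [cpow_gam hδ, gam_conv (by positivity) (by positivity)]
    congr 1
    rw [pow_succ]; field_simp; ring
  have hpos : ∀ k : ℕ, 1 ≤ k → (0:ℝ) < k / 2 ^ m := fun k hk => by positivity
  have h := majo_lower hρ T hT (gam n (1 / 2 ^ (m + 1))) N x
    (fun k hk => by
      obtain ⟨k, rfl⟩ : ∃ l, k = l + 1 := ⟨k - 1, by omega⟩
      rw [cpow_gam hδ, gam_neg]) f hfm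
    (fun k hk => by rw [hc k hk]; exact heat_integrable (hpos k hk) f hf x) J κ hκ h1 hN
  refine le_trans (le_of_eq ?_) h
  congr 2
  apply Finset.sum_congr rfl
  intro i hi
  have hi' := Finset.mem_range.1 hi
  rw [hc _ (h1 i hi'.le), hc _ (h1 (i + 1) hi'), heatOp_eq (hpos _ (h1 i hi'.le)),
    heatOp_eq (hpos _ (h1 (i + 1) hi'))]

/-- reduce `eVar` bounds to finite sums -/
lemma eVar_le {ρ : ℝ} (hρ : 1 ≤ ρ) (F : ℝ → ℝ) (A : ℝ≥0∞)
    (h : ∀ t, NullSeq t → ∀ J : ℕ, ENNReal.ofReal ((∑ i ∈ Finset.range J, |F (t i) - F (t (i + 1))| ^ ρ) ^ (1 / ρ)) ≤ A) :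
    eVar ρ F ≤ A := by
  unfold eVar
  apply iSup_le
  rintro ⟨t, ht⟩
  rw [one_div, ENNReal.rpow_inv_le_iff (by linarith)]
  rw [ENNReal.tsum_eq_iSup_nat]
  apply iSup_le
  intro J
  have h1 := h t ht J
  rw [← ENNReal.ofReal_rpow_of_nonneg (Finset.sum_nonneg fun i _ => by positivity) (by positivity),
    one_div, ENNReal.rpow_inv_le_iff (by linarith), ENNReal.ofReal_sum_of_nonneg (fun i _ => by positivity)] at h1
  exact h1

theorem local_bound {ρ : ℝ} (hρ : 2 < ρ) : ∃ C > 0, ∀ (f : EuclideanSpace ℝ (Fin n) → ℝ),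
    Measurable f → Integrable f → ∀ T : ℝ, 0 < T → ∀ B : Set (EuclideanSpace ℝ (Fin n)),
    ∃ g : EuclideanSpace ℝ (Fin n) → ℝ≥0∞, Measurable g ∧
      (∀ x, eVar ρ (fun t => heatOp n t f x) ≤ g x) ∧
      ∫⁻ x in B, g x ≤ ENNReal.ofReal T * (volume B +
      ENNReal.ofReal C * (ENNReal.ofReal (T ^ 2)⁻¹ * ∫⁻ x, ENNReal.ofReal (f x ^ 2))) := by
  obtain ⟨C, hC0, hC⟩ := tsum_wt hρ
  refine ⟨C, hC0, ?_⟩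
  intro f hfm hf T hT B
  have hpr : ∀ m : ℕ, IsProbabilityMeasure (gam n (1 / 2 ^ (m + 1))) := fun m => gam_prob (by positivity)
  have hmm : ∀ m : ℕ, Measurable (majo ρ T (gam n (1 / 2 ^ (m + 1))) f (4 ^ m)) := fun m =>
    majo_measurable ρ T _ f hfm _
  refine ⟨fun x => liminf (fun m : ℕ => majo ρ T (gam n (1 / 2 ^ (m + 1))) f (4 ^ m) x) atTop,
    Measurable.liminf hmm, ?_, ?_⟩
  · intro x
    apply eVar_le (by linarith)
    intro t ht J
    obtain ⟨hanti, hpos, -⟩ := ht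
    let κ : ℕ → ℕ → ℕ := fun m i => ⌊t i * 2 ^ m⌋₊
    have hconv : ∀ i, Tendsto (fun m : ℕ => ((κ m i : ℕ) : ℝ) / 2 ^ m) atTop (nhds (t i)) := by
      intro i
      have h1 := tendsto_nat_floor_mul_div_atTop (R := ℝ) (hpos i).le
      have h2 : Tendsto (fun m : ℕ => (2:ℝ) ^ m) atTop atTop := tendsto_pow_atTop_atTop_of_one_lt (by norm_num)
      exact h1.comp h2
    have hF : ∀ i, Tendsto (fun m : ℕ => heatOp n (((κ m i : ℕ) : ℝ) / 2 ^ m) f x) atTop (nhds (heatOp n (t i) f x)) := by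
      intro i
      have hc := (heat_cont f hf x).continuousAt (Ioi_mem_nhds (hpos i))
      exact hc.tendsto.comp (hconv i)
    have hlim : Tendsto (fun m : ℕ => ENNReal.ofReal ((∑ i ∈ Finset.range J,
      |heatOp n (κ m i / 2 ^ m) f x - heatOp n (κ m (i + 1) / 2 ^ m) f x| ^ ρ) ^ (1 / ρ))) atTop
      (nhds (ENNReal.ofReal ((∑ i ∈ Finset.range J, |heatOp n (t i) f x - heatOp n (t (i + 1)) f x| ^ ρ) ^ (1 / ρ)))) := by
      apply ENNReal.tendsto_ofReal
      apply Tendsto.rpow_const _ (Or.inr (by positivity))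
      apply tendsto_finsetSum
      intro i _
      exact Tendsto.rpow_const ((hF i).sub (hF (i + 1))).abs (Or.inr (by linarith))
    rw [← hlim.liminf_eq]
    refine liminf_le_liminf ?_
    have ev1 : ∀ᶠ m : ℕ in atTop, 1 ≤ t J * 2 ^ m := by
      have h2 : Tendsto (fun m : ℕ => (2:ℝ) ^ m) atTop atTop := tendsto_pow_atTop_atTop_of_one_lt (by norm_num)
      exact (h2.const_mul_atTop (hpos J)).eventually_ge_atTop 1
    have ev2 : ∀ᶠ m : ℕ in atTop, t 0 ≤ 2 ^ m := by
      have h2 : Tendsto (fun m : ℕ => (2:ℝ) ^ m) atTop atTop := tendsto_pow_atTop_atTop_of_one_lt (by norm_num)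
      exact h2.eventually_ge_atTop _
    filter_upwards [ev1, ev2] with m hm1 hm2
    apply dyadic_lower (by linarith) T hT f hfm hf x m (4 ^ m) J (κ m)
    · intro i j hij
      apply Nat.floor_mono
      gcongr
      exact hanti.antitone hij
    · intro i hi
      apply Nat.le_floor
      push_cast
      refine hm1.trans ?_
      gcongr
      exact hanti.antitone hi
    · apply Nat.floor_le_of_le
      push_cast
      calc t 0 * 2 ^ m ≤ 2 ^ m * 2 ^ m := by gcongr
        _ = 4 ^ m := by rw [← mul_pow]; norm_num
  · refine (lintegral_liminf_le hmm).trans ?_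
    refine liminf_le_of_frequently_le' (Frequently.of_forall fun m => ?_)
    exact majo_integral hC T hT _ f hfm _ B
end Part4

section Part5
variable {n : ℕ}

lemma eVar_ge {ρ : ℝ} (hρ : 1 ≤ ρ) (F : ℝ → ℝ) (t : ℕ → ℝ) (ht : NullSeq t) (J : ℕ) :
    ENNReal.ofReal ((∑ i ∈ Finset.range J, |F (t i) - F (t (i + 1))| ^ ρ) ^ (1 / ρ)) ≤ eVar ρ F := by
  refine le_trans ?_ (le_iSup (fun t : {t : ℕ → ℝ // NullSeq t} =>
    (∑' j : ℕ, ENNReal.ofReal (|F (t.1 j) - F (t.1 (j + 1))| ^ ρ)) ^ (1 / ρ)) ⟨t, ht⟩)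
  rw [← ENNReal.ofReal_rpow_of_nonneg (Finset.sum_nonneg fun i _ => by positivity) (by positivity),
    ENNReal.ofReal_sum_of_nonneg (fun i _ => by positivity)]
  apply ENNReal.rpow_le_rpow _ (by positivity)
  exact ENNReal.sum_le_tsum _

lemma eVar_add {ρ : ℝ} (hρ : 1 ≤ ρ) (F G : ℝ → ℝ) :
    eVar ρ (fun t => F t + G t) ≤ eVar ρ F + eVar ρ G := by
  apply eVar_le hρ
  intro t ht J
  refine le_trans ?_ (add_le_add (eVar_ge hρ F t ht J) (eVar_ge hρ G t ht J))
  rw [← ENNReal.ofReal_add (by positivity) (by positivity)]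
  apply ENNReal.ofReal_le_ofReal
  have h := Real.Lp_add_le (Finset.range J) (fun i => F (t i) - F (t (i + 1)))
    (fun i => G (t i) - G (t (i + 1))) hρ
  refine le_trans (le_of_eq ?_) h
  congr 1
  apply Finset.sum_congr rfl
  intro i _
  congr 2
  ring

lemma eVar_congr {ρ : ℝ} {F G : ℝ → ℝ} (h : ∀ t s, 0 < t → 0 < s → |F t - F s| = |G t - G s|) :
    eVar ρ F = eVar ρ G := by
  unfold eVar
  congr 1
  ext ⟨t, ht⟩
  congr 2
  ext j
  rw [h _ _ (ht.2.1 j) (ht.2.1 (j + 1))]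

lemma eVar_le_l1 {ρ : ℝ} (hρ : 1 ≤ ρ) (F : ℝ → ℝ) (A : ℝ)
    (h : ∀ t, NullSeq t → ∀ J : ℕ, ∑ i ∈ Finset.range J, |F (t i) - F (t (i + 1))| ≤ A) :
    eVar ρ F ≤ ENNReal.ofReal A := by
  apply eVar_le hρ
  intro t ht J
  apply ENNReal.ofReal_le_ofReal
  refine le_trans ?_ (h t ht J)
  have h1 : ∀ s : Finset ℕ, ∀ a : ℕ → ℝ, (∀ i, 0 ≤ a i) → ∑ i ∈ s, a i ^ ρ ≤ (∑ i ∈ s, a i) ^ ρ := by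
    intro s a ha
    induction s using Finset.induction_on with
    | empty => simp; positivity
    | insert i s hi ih =>
      rw [Finset.sum_insert hi, Finset.sum_insert hi]
      refine le_trans (by gcongr) (Real.add_rpow_le_rpow_add (ha i) (Finset.sum_nonneg fun j _ => ha j) hρ)
  have h2 := h1 (Finset.range J) (fun i => |F (t i) - F (t (i + 1))|) (fun i => abs_nonneg _)
  have h3 : 0 ≤ ∑ i ∈ Finset.range J, |F (t i) - F (t (i + 1))| := Finset.sum_nonneg fun i _ => abs_nonneg _
  calc _ ≤ ((∑ i ∈ Finset.range J, |F (t i) - F (t (i + 1))|) ^ ρ) ^ (1 / ρ) := by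
        apply Real.rpow_le_rpow (Finset.sum_nonneg fun i _ => by positivity) h2 (by positivity)
    _ = _ := by rw [← Real.rpow_mul h3, mul_one_div_cancel (by linarith), Real.rpow_one]

lemma unimodal_var (h : ℝ → ℝ) (p A : ℝ) (h0 : ∀ t, 0 < t → 0 ≤ h t) (hA : ∀ t, 0 < t → h t ≤ A) (hp : 0 < p)
    (h1 : ∀ s t, 0 < s → s ≤ t → t ≤ p → h s ≤ h t)
    (h2 : ∀ s t, p ≤ s → s ≤ t → h t ≤ h s) (t : ℕ → ℝ) (ht : NullSeq t) (J : ℕ) :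
    ∑ i ∈ Finset.range J, |h (t i) - h (t (i + 1))| ≤ 2 * A := by
  obtain ⟨ha, hpos, -⟩ := ht
  let U : ℝ → ℝ := fun t => if t ≤ p then h t else 2 * h p - h t
  have hU : ∀ s t, 0 < s → s ≤ t → |h t - h s| ≤ U t - U s := by
    intro s t hs hst
    simp only [U]
    by_cases htp : t ≤ p
    · have hsp : s ≤ p := hst.trans htp
      rw [if_pos htp, if_pos hsp, abs_of_nonneg (sub_nonneg.2 (h1 s t hs hst htp))]
    · rw [if_neg htp]
      by_cases hsp : s ≤ p
      · rw [if_pos hsp]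
        have e1 := h1 s p hs hsp le_rfl
        have e2 := h2 p t le_rfl (not_le.1 htp).le
        rw [abs_le]; constructor <;> linarith
      · rw [if_neg hsp]
        have e2 := h2 s t (not_le.1 hsp).le hst
        rw [abs_le]; constructor <;> linarith
  calc ∑ i ∈ Finset.range J, |h (t i) - h (t (i + 1))| ≤ ∑ i ∈ Finset.range J, (U (t i) - U (t (i + 1))) :=
        Finset.sum_le_sum fun i _ => hU _ _ (hpos _) (ha (Nat.lt_succ_self i)).le
    _ = U (t 0) - U (t J) := Finset.sum_range_sub' (fun i => U (t i)) J
    _ ≤ 2 * A := by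
        have e1 : U (t 0) ≤ 2 * A := by
          simp only [U]
          split_ifs
          · have := h0 _ (hpos 0); have := hA _ (hpos 0); linarith
          · have := h0 _ (hpos 0); have := hA p hp; linarith
        have e2 : 0 ≤ U (t J) := by
          simp only [U]
          split_ifs with hh
          · exact h0 _ (hpos J)
          · have := h2 p (t J) le_rfl (not_le.1 hh).le
            have := h0 p hp
            linarith
        linarith

lemma hq_var {α b : ℝ} (hα : 0 < α) (hb : 0 < b) (t : ℕ → ℝ) (ht : NullSeq t) (J : ℕ) :
    ∑ i ∈ Finset.range J, |(t i) ^ (-α) * Real.exp (-b / t i) - (t (i + 1)) ^ (-α) * Real.exp (-b / t (i + 1))|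
      ≤ 2 * (α / b) ^ α := by
  have key : ∀ t : ℝ, 0 < t → t ^ (-α) * Real.exp (-b / t) = Real.exp (-α * Real.log t - b / t) := by
    intro t ht
    rw [Real.rpow_def_of_pos ht, ← Real.exp_add]
    congr 1; ring
  apply unimodal_var (fun t => t ^ (-α) * Real.exp (-b / t)) (b / α) _ _ _ (by positivity) _ _ t ht J
  · intro t ht; positivity
  · intro t ht
    have e1 : b / (α * t) ≤ Real.exp (b / (α * t)) := by
      have := Real.add_one_le_exp (b / (α * t)); linarith
    have e2 : (b / (α * t)) ^ α ≤ Real.exp (b / t) := by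
      refine (Real.rpow_le_rpow (by positivity) e1 hα.le).trans (le_of_eq ?_)
      rw [← Real.exp_mul]; congr 1; field_simp
    have e3 : t ^ (-α) = (α / b) ^ α * (b / (α * t)) ^ α := by
      rw [← Real.mul_rpow (by positivity) (by positivity), Real.rpow_neg ht.le, ← Real.inv_rpow ht.le]
      congr 1; field_simp
    rw [e3, mul_assoc]
    apply mul_le_of_le_one_right (by positivity)
    rw [neg_div, Real.exp_neg]
    rw [mul_inv_le_iff₀ (Real.exp_pos _)]; linarith
  · intro s t hs hst htp
    have htt : 0 < t := hs.trans_le hst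
    rw [key s hs, key t htt, Real.exp_le_exp]
    have e1 : Real.log (t / s) ≤ t / s - 1 := Real.log_le_sub_one_of_pos (by positivity)
    rw [Real.log_div htt.ne' hs.ne'] at e1
    have e2 : α ≤ b / t := by rw [le_div_iff₀ htt]; rw [le_div_iff₀ hα] at htp; linarith
    have e3 : b / s - b / t = b / t * (t / s - 1) := by field_simp
    have e4 : 0 ≤ t / s - 1 := by rw [sub_nonneg, le_div_iff₀ hs]; linarith
    have e5 := mul_le_mul_of_nonneg_left e1 hα.le
    have e6 := mul_le_mul_of_nonneg_right e2 e4
    linarith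
  · intro s t hs hst
    have hss : 0 < s := lt_of_lt_of_le (by positivity) hs
    have htt : 0 < t := hss.trans_le hst
    rw [key s hss, key t htt, Real.exp_le_exp]
    have e1 : 1 - (t / s)⁻¹ ≤ Real.log (t / s) := Real.one_sub_inv_le_log_of_pos (by positivity)
    rw [Real.log_div htt.ne' hss.ne'] at e1
    have e2 : b / s ≤ α := by rw [div_le_iff₀ hss]; rw [div_le_iff₀ hα] at hs; linarith
    have e3 : b / s - b / t = b / s * (1 - (t / s)⁻¹) := by field_simp
    have e4 : 0 ≤ 1 - (t / s)⁻¹ := by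
      rw [sub_nonneg]; apply inv_le_one_of_one_le₀; rw [le_div_iff₀ hss]; linarith
    have e5 := mul_le_mul_of_nonneg_left e1 hα.le
    have e6 := mul_le_mul_of_nonneg_right e2 e4
    linarith

/-- heat kernel as function of time and squared distance -/
def kq (n : ℕ) (t q : ℝ) : ℝ := (4 * Real.pi * t) ^ (-(n : ℝ) / 2) * Real.exp (-q / (4 * t))

lemma kq_deriv {t : ℝ} (ht : 0 < t) (q : ℝ) : HasDerivAt (kq n t)
    (-((4 * Real.pi) ^ (-(n : ℝ) / 2) / 4) * (t ^ (-((n:ℝ) / 2 + 1)) * Real.exp (-(q / 4) / t))) q := by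
  have h1 : HasDerivAt (fun q : ℝ => -q / (4 * t)) (-1 / (4 * t)) q := (hasDerivAt_id q).neg.div_const _
  have h2 := (h1.exp).const_mul ((4 * Real.pi * t) ^ (-(n : ℝ) / 2))
  refine HasDerivAt.congr_deriv (f := kq n t) h2 ?_
  rw [Real.mul_rpow (by positivity) ht.le]
  have : t ^ (-((n:ℝ) / 2 + 1)) = t ^ (-(n : ℝ) / 2) * t⁻¹ := by
    rw [← Real.rpow_neg_one, ← Real.rpow_add ht]; congr 1; ring
  rw [this]
  have e : -(q / 4) / t = -q / (4 * t) := by field_simp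
  rw [e]; field_simp

lemma kq_var {m q q1 : ℝ} (hm : 0 < m) (hq : m ≤ q) (hq1 : m ≤ q1) (t : ℕ → ℝ) (ht : NullSeq t) (J : ℕ) :
    ∑ i ∈ Finset.range J, |(kq n (t i) q - kq n (t (i + 1)) q) - (kq n (t i) q1 - kq n (t (i + 1)) q1)|
      ≤ ((4 * Real.pi) ^ (-(n : ℝ) / 2) / 4) * (2 * (((n:ℝ) / 2 + 1) / (m / 4)) ^ ((n:ℝ) / 2 + 1)) * |q - q1| := by
  set c := ((4 * Real.pi) ^ (-(n : ℝ) / 2) / 4) with hc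
  have hc0 : 0 ≤ c := by positivity
  set α := (n:ℝ) / 2 + 1 with hα
  have hα0 : 0 < α := by positivity
  let a : ℕ → ℝ := fun i => (kq n (t i) q - kq n (t (i + 1)) q) - (kq n (t i) q1 - kq n (t (i + 1)) q1)
  let ε : ℕ → ℝ := fun i => SignType.sign (a i)
  have hε : ∀ i, |ε i| ≤ 1 := by
    intro i; simp only [ε]
    rcases lt_trichotomy (a i) 0 with h | h | h <;> simp [h]
  let Ψ : ℝ → ℝ := fun q => ∑ i ∈ Finset.range J, ε i * (kq n (t i) q - kq n (t (i + 1)) q)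
  let h : ℝ → ℝ → ℝ := fun q t => t ^ (-α) * Real.exp (-(q / 4) / t)
  have hd : ∀ q ∈ Ici m, HasDerivWithinAt Ψ
      (∑ i ∈ Finset.range J, ε i * (-c * h q (t i) - -c * h q (t (i + 1)))) (Ici m) q := by
    intro q _
    apply HasDerivAt.hasDerivWithinAt
    apply HasDerivAt.fun_sum
    intro i _
    exact ((kq_deriv (ht.2.1 i) q).sub (kq_deriv (ht.2.1 (i + 1)) q)).const_mul _
  have hb : ∀ q ∈ Ici m, ‖∑ i ∈ Finset.range J, ε i * (-c * h q (t i) - -c * h q (t (i + 1)))‖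
      ≤ c * (2 * (α / (m / 4)) ^ α) := by
    intro q hq
    have hq0 : 0 < q := lt_of_lt_of_le hm hq
    calc _ ≤ ∑ i ∈ Finset.range J, c * |h q (t i) - h q (t (i + 1))| := by
          refine (norm_sum_le _ _).trans (Finset.sum_le_sum fun i _ => ?_)
          have : ε i * (-c * h q (t i) - -c * h q (t (i + 1))) = ε i * (-c * (h q (t i) - h q (t (i + 1)))) := by ring
          rw [this, Real.norm_eq_abs, abs_mul, abs_mul, abs_neg, abs_of_nonneg hc0]
          exact mul_le_of_le_one_left (by positivity) (hε i)
      _ = c * ∑ i ∈ Finset.range J, |h q (t i) - h q (t (i + 1))| := by rw [Finset.mul_sum]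
      _ ≤ c * (2 * (α / (q / 4)) ^ α) := by
          apply mul_le_mul_of_nonneg_left _ hc0
          exact hq_var hα0 (by positivity) t ht J
      _ ≤ _ := by
          have : m ≤ q := hq
          gcongr
  have := (convex_Ici m).norm_image_sub_le_of_norm_hasDerivWithin_le hd hb hq1 hq
  rw [Real.norm_eq_abs, Real.norm_eq_abs] at this
  refine le_trans (le_of_eq ?_) ((le_abs_self _).trans this)
  simp only [Ψ]
  rw [← Finset.sum_sub_distrib]
  apply Finset.sum_congr rfl
  intro i _
  rw [← mul_sub]
  exact (sign_mul_self (a i)).symm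

lemma kq_var2 (n : ℕ) : ∃ C > 0, ∀ (x0 x x1 y : EuclideanSpace ℝ (Fin n)) (r : ℝ), 0 < r →
    x ∈ Metric.ball x0 r → x1 ∈ Metric.ball x0 r → y ∉ Metric.ball x0 (2 * r) →
    ∀ t, NullSeq t → ∀ J : ℕ,
    ∑ i ∈ Finset.range J, |(kq n (t i) (‖x - y‖ ^ 2) - kq n (t (i + 1)) (‖x - y‖ ^ 2))
      - (kq n (t i) (‖x1 - y‖ ^ 2) - kq n (t (i + 1)) (‖x1 - y‖ ^ 2))| ≤ C * r * (‖y - x0‖ ^ (n + 1))⁻¹ := by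
  refine ⟨((4 * Real.pi) ^ (-(n : ℝ) / 2) / 4) * (2 * (16 * ((n:ℝ) / 2 + 1)) ^ ((n:ℝ) / 2 + 1)) * 6,
    by positivity, ?_⟩
  intro x0 x x1 y r hr hx hx1 hy t ht J
  rw [mem_ball_iff_norm] at hx hx1 hy
  rw [not_lt] at hy
  set d := ‖y - x0‖ with hd
  have hd0 : 0 < d := by linarith
  have lo : ∀ z : EuclideanSpace ℝ (Fin n), ‖z - x0‖ < r → d / 2 ≤ ‖z - y‖ ∧ ‖z - y‖ ≤ 3 / 2 * d := by
    intro z hz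
    have e1 : y - x0 = (z - x0) - (z - y) := by abel
    have e2 : z - y = (z - x0) - (y - x0) := by abel
    have e3 := norm_sub_le (z - x0) (z - y)
    have e4 := norm_sub_le (z - x0) (y - x0)
    rw [← e1] at e3; rw [← e2] at e4
    constructor <;> linarith
  obtain ⟨a1, a2⟩ := lo x hx
  obtain ⟨b1, b2⟩ := lo x1 hx1
  have h := kq_var (n := n) (m := d ^ 2 / 4) (q := ‖x - y‖ ^ 2) (q1 := ‖x1 - y‖ ^ 2) (by positivity)
    (by nlinarith) (by nlinarith) t ht J
  refine h.trans ?_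
  have hx1x : |‖x - y‖ - ‖x1 - y‖| ≤ 2 * r := by
    refine (abs_norm_sub_norm_le _ _).trans ?_
    have e : x - y - (x1 - y) = (x - x0) - (x1 - x0) := by abel
    rw [e]; refine (norm_sub_le _ _).trans (by linarith)
  have hq : |‖x - y‖ ^ 2 - ‖x1 - y‖ ^ 2| ≤ 6 * r * d := by
    have : ‖x - y‖ ^ 2 - ‖x1 - y‖ ^ 2 = (‖x - y‖ - ‖x1 - y‖) * (‖x - y‖ + ‖x1 - y‖) := by ring
    rw [this, abs_mul, abs_of_nonneg (by positivity : 0 ≤ ‖x - y‖ + ‖x1 - y‖)]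
    calc _ ≤ (2 * r) * (3 * d) := by
          apply mul_le_mul hx1x (by linarith) (by positivity) (by positivity)
      _ = _ := by ring
  have e : (((n:ℝ) / 2 + 1) / (d ^ 2 / 4 / 4)) ^ ((n:ℝ) / 2 + 1)
      = (16 * ((n:ℝ) / 2 + 1)) ^ ((n:ℝ) / 2 + 1) * (d ^ (n + 2))⁻¹ := by
    have : ((n:ℝ) / 2 + 1) / (d ^ 2 / 4 / 4) = (16 * ((n:ℝ) / 2 + 1)) * (d ^ 2)⁻¹ := by field_simp; norm_num
    rw [this, Real.mul_rpow (by positivity) (by positivity), Real.inv_rpow (by positivity)]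
    congr 2
    rw [← Real.rpow_natCast, ← Real.rpow_mul hd0.le, ← Real.rpow_natCast]
    congr 1
    push_cast; ring
  rw [e]
  refine (mul_le_mul_of_nonneg_left hq (by positivity)).trans (le_of_eq ?_)
  have : (d ^ (n + 2))⁻¹ * d = (d ^ (n + 1))⁻¹ := by field_simp; ring
  rw [← this]; ring
end Part5

section Part6
variable {n : ℕ}

/-- volume of the unit ball -/
def om (n : ℕ) : ℝ := (volume (Metric.ball (0 : EuclideanSpace ℝ (Fin n)) 1)).toReal

lemma om_pos : 0 < om n := by
  unfold om
  exact ENNReal.toReal_pos (Metric.measure_ball_pos volume _ one_pos).ne' measure_ball_lt_top.ne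

lemma vol_ball (x : EuclideanSpace ℝ (Fin n)) {r : ℝ} (hr : 0 ≤ r) (hn : 1 ≤ n) :
    volume (Metric.ball x r) = ENNReal.ofReal (r ^ n * om n) := by
  have : NeZero n := ⟨by omega⟩
  rw [Measure.addHaar_ball volume x hr, finrank_euclideanSpace_fin, ENNReal.ofReal_mul (by positivity), om,
    ENNReal.ofReal_toReal measure_ball_lt_top.ne]

lemma vol_ball' (x : EuclideanSpace ℝ (Fin n)) {r : ℝ} (hr : 0 ≤ r) (hn : 1 ≤ n) :
    (volume (Metric.ball x r)).toReal = r ^ n * om n := by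
  rw [vol_ball x hr hn, ENNReal.toReal_ofReal (mul_nonneg (by positivity) om_pos.le)]

lemma li_ball {f : EuclideanSpace ℝ (Fin n) → ℝ} (hf : LocallyIntegrable f volume)
    (x : EuclideanSpace ℝ (Fin n)) (r : ℝ) : IntegrableOn f (Metric.ball x r) :=
  (hf.integrableOn_isCompact (isCompact_closedBall x r)).mono_set Metric.ball_subset_closedBall

lemma intOn_sub {f : EuclideanSpace ℝ (Fin n) → ℝ} {S : Set (EuclideanSpace ℝ (Fin n))}
    (hf : IntegrableOn f S) (hS : volume S ≠ ⊤) (c : ℝ) : IntegrableOn (fun y => |f y - c|) S :=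
  (hf.sub (integrableOn_const hS)).abs

lemma avg_sub_le {f : EuclideanSpace ℝ (Fin n) → ℝ} {S : Set (EuclideanSpace ℝ (Fin n))}
    (hf : IntegrableOn f S) (hS : volume S ≠ ⊤) (hS0 : volume S ≠ 0) (c : ℝ) :
    |avgOn f S - c| ≤ (volume S).toReal⁻¹ * ∫ y in S, |f y - c| := by
  have h0 : 0 < (volume S).toReal := ENNReal.toReal_pos hS0 hS
  have : avgOn f S - c = (volume S).toReal⁻¹ * ∫ y in S, (f y - c) := by
    rw [integral_sub hf (integrableOn_const hS), avgOn, mul_sub]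
    congr 1
    rw [setIntegral_const, smul_eq_mul, Measure.real]
    field_simp
  rw [this, abs_mul, abs_of_nonneg (by positivity)]
  exact mul_le_mul_of_nonneg_left (abs_integral_le_integral_abs) (by positivity)

lemma bmo_nonneg {f : EuclideanSpace ℝ (Fin n) → ℝ} {M : ℝ} (h : IsBMOWith f M) : 0 ≤ M :=
  le_trans (mul_nonneg (by positivity) (integral_nonneg fun _ => abs_nonneg _)) (h 0 1 one_pos)

lemma bmo_int {f : EuclideanSpace ℝ (Fin n) → ℝ} {M : ℝ} (hn : 1 ≤ n) (h : IsBMOWith f M)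
    (x : EuclideanSpace ℝ (Fin n)) {r : ℝ} (hr : 0 < r) :
    ∫ y in Metric.ball x r, |f y - avgOn f (Metric.ball x r)| ≤ M * (r ^ n * om n) := by
  have h1 := h x r hr
  have := om_pos (n := n)
  rw [vol_ball' x hr.le hn, inv_mul_le_iff₀ (by positivity)] at h1
  linarith

lemma bmo_double {f : EuclideanSpace ℝ (Fin n) → ℝ} {M : ℝ} (hn : 1 ≤ n) (hf : LocallyIntegrable f volume)
    (h : IsBMOWith f M) (x : EuclideanSpace ℝ (Fin n)) {r : ℝ} (hr : 0 < r) :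
    |avgOn f (Metric.ball x (2 * r)) - avgOn f (Metric.ball x r)| ≤ 2 ^ n * M := by
  have h1 := avg_sub_le (li_ball hf x r) measure_ball_lt_top.ne (Metric.measure_ball_pos volume _ hr).ne'
    (avgOn f (Metric.ball x (2 * r)))
  have := om_pos (n := n)
  rw [abs_sub_comm]
  refine h1.trans ?_
  rw [vol_ball' x hr.le hn, inv_mul_le_iff₀ (by positivity)]
  calc _ ≤ ∫ y in Metric.ball x (2 * r), |f y - avgOn f (Metric.ball x (2 * r))| := by
        apply setIntegral_mono_set (intOn_sub (li_ball hf x _) measure_ball_lt_top.ne _)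
          (ae_of_all _ fun _ => abs_nonneg _)
        exact (Metric.ball_subset_ball (by linarith)).eventuallyLE
    _ ≤ M * ((2 * r) ^ n * om n) := bmo_int hn h x (by positivity)
    _ = _ := by rw [mul_pow]; ring

lemma bmo_shift {f : EuclideanSpace ℝ (Fin n) → ℝ} {M : ℝ} (hn : 1 ≤ n) (hf : LocallyIntegrable f volume)
    (h : IsBMOWith f M) (x : EuclideanSpace ℝ (Fin n)) {r : ℝ} (hr : 0 < r) (k : ℕ) :
    |avgOn f (Metric.ball x (2 ^ k * r)) - avgOn f (Metric.ball x r)| ≤ k * (2 ^ n * M) := by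
  induction k with
  | zero => simp
  | succ k ih =>
    have h1 := bmo_double hn hf h x (r := 2 ^ k * r) (by positivity)
    have e : 2 ^ (k + 1) * r = 2 * (2 ^ k * r) := by ring
    rw [e]
    have := abs_sub_le (avgOn f (Metric.ball x (2 * (2 ^ k * r)))) (avgOn f (Metric.ball x (2 ^ k * r)))
      (avgOn f (Metric.ball x r))
    push_cast
    linarith

lemma bmo_big {f : EuclideanSpace ℝ (Fin n) → ℝ} {M : ℝ} (hn : 1 ≤ n) (hf : LocallyIntegrable f volume)
    (h : IsBMOWith f M) (x : EuclideanSpace ℝ (Fin n)) {r : ℝ} (hr : 0 < r) (k : ℕ) :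
    ∫⁻ y in Metric.ball x (2 ^ k * r), ENNReal.ofReal |f y - avgOn f (Metric.ball x r)|
      ≤ ENNReal.ofReal ((1 + k * 2 ^ n) * M * ((2 ^ k * r) ^ n * om n)) := by
  have hM := bmo_nonneg h
  have hom := om_pos (n := n)
  have hr' : 0 < 2 ^ k * r := by positivity
  rw [← ofReal_integral_eq_lintegral_ofReal (intOn_sub (li_ball hf x _) measure_ball_lt_top.ne _)
    (ae_of_all _ fun _ => abs_nonneg _)]
  apply ENNReal.ofReal_le_ofReal
  have hi := (intOn_sub (li_ball hf x (2 ^ k * r)) measure_ball_lt_top.ne (avgOn f (Metric.ball x (2 ^ k * r))))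
  calc _ ≤ ∫ y in Metric.ball x (2 ^ k * r), (|f y - avgOn f (Metric.ball x (2 ^ k * r))| + k * (2 ^ n * M)) := by
        apply integral_mono (intOn_sub (li_ball hf x _) measure_ball_lt_top.ne _)
          (hi.add (integrableOn_const measure_ball_lt_top.ne))
        intro y
        have e1 := bmo_shift hn hf h x hr k
        have e2 := abs_sub_le (f y) (avgOn f (Metric.ball x (2 ^ k * r))) (avgOn f (Metric.ball x r))
        show _ ≤ |f y - avgOn f (Metric.ball x (2 ^ k * r))| + k * (2 ^ n * M)
        linarith
    _ = (∫ y in Metric.ball x (2 ^ k * r), |f y - avgOn f (Metric.ball x (2 ^ k * r))|)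
        + (2 ^ k * r) ^ n * om n * (k * (2 ^ n * M)) := by
        rw [integral_add hi (integrableOn_const measure_ball_lt_top.ne), setIntegral_const, smul_eq_mul, Measure.real,
          vol_ball' x hr'.le hn]
    _ ≤ M * ((2 ^ k * r) ^ n * om n) + (2 ^ k * r) ^ n * om n * (k * (2 ^ n * M)) := by
        gcongr; exact bmo_int hn h x hr'
    _ = _ := by ring

lemma tail_bound (hn : 1 ≤ n) : ∃ C > 0, ∀ (f : EuclideanSpace ℝ (Fin n) → ℝ) (M : ℝ),
    LocallyIntegrable f volume → IsBMOWith f M → ∀ (x : EuclideanSpace ℝ (Fin n)) (r : ℝ), 0 < r →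
    ∫⁻ y in (Metric.ball x r)ᶜ, ENNReal.ofReal (|f y - avgOn f (Metric.ball x r)| * (‖y - x‖ ^ (n + 1))⁻¹)
      ≤ ENNReal.ofReal (C * M / r) := by
  have hom := om_pos (n := n)
  let u : ℕ → ℝ := fun k => (1 + (k + 1 : ℕ) * 2 ^ n) * 2 ^ n * om n * (1 / 2) ^ k
  have hu : Summable u := by
    have h1 : Summable (fun k : ℕ => (k : ℝ) * (1 / 2 : ℝ) ^ k) := by
      have := summable_pow_mul_geometric_of_norm_lt_one (R := ℝ) 1 (r := 1 / 2) (by norm_num)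
      simpa using this
    have h2 : Summable (fun k : ℕ => (1 / 2 : ℝ) ^ k) := summable_geometric_of_lt_one (by norm_num) (by norm_num)
    have := (h1.mul_left (2 ^ n * 2 ^ n * om n)).add (h2.mul_left ((1 + 2 ^ n) * 2 ^ n * om n))
    refine this.congr fun k => ?_
    simp only [u]; push_cast; ring
  have hu0 : ∀ k, 0 < u k := fun k => by simp only [u]; positivity
  refine ⟨∑' k, u k, hu.tsum_pos (fun k => (hu0 k).le) 0 (hu0 0), ?_⟩
  intro f M hf h x r hr
  have hM := bmo_nonneg h
  let S : ℕ → Set (EuclideanSpace ℝ (Fin n)) := fun k => Metric.ball x (2 ^ (k + 1) * r) \ Metric.ball x (2 ^ k * r)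
  have hcov : (Metric.ball x r)ᶜ ⊆ ⋃ k, S k := by
    intro y hy
    have hex : ∃ k : ℕ, y ∈ Metric.ball x (2 ^ k * r) := by
      obtain ⟨k, hk⟩ := pow_unbounded_of_one_lt (dist y x / r) (one_lt_two)
      exact ⟨k, by rw [Metric.mem_ball]; rwa [div_lt_iff₀ hr] at hk⟩
    classical
    have hne : Nat.find hex ≠ 0 := by
      intro h0
      have := Nat.find_spec hex
      rw [h0] at this
      apply hy; simpa using this
    obtain ⟨k, hk⟩ := Nat.exists_eq_succ_of_ne_zero hne
    rw [mem_iUnion]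
    refine ⟨k, ?_, ?_⟩
    · have := Nat.find_spec hex; rwa [hk] at this
    · exact Nat.find_min hex (by omega)
  calc _ ≤ ∫⁻ y in ⋃ k, S k, ENNReal.ofReal (|f y - avgOn f (Metric.ball x r)| * (‖y - x‖ ^ (n + 1))⁻¹) :=
        lintegral_mono_set hcov
    _ ≤ ∑' k, ∫⁻ y in S k, ENNReal.ofReal (|f y - avgOn f (Metric.ball x r)| * (‖y - x‖ ^ (n + 1))⁻¹) :=
        lintegral_iUnion_le _ _
    _ ≤ ∑' k, ENNReal.ofReal (u k * (M / r)) := by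
        apply ENNReal.tsum_le_tsum
        intro k
        calc _ ≤ ∫⁻ y in S k, ENNReal.ofReal |f y - avgOn f (Metric.ball x r)| * ENNReal.ofReal (((2 ^ k * r) ^ (n + 1))⁻¹) := by
              apply setLIntegral_mono' (measurableSet_ball.diff measurableSet_ball)
              intro y hy
              rw [← ENNReal.ofReal_mul (abs_nonneg _)]
              apply ENNReal.ofReal_le_ofReal
              have : 2 ^ k * r ≤ ‖y - x‖ := by
                have := hy.2; rw [mem_ball_iff_norm, not_lt] at this; exact this
              gcongr
          _ = (∫⁻ y in S k, ENNReal.ofReal |f y - avgOn f (Metric.ball x r)|) * ENNReal.ofReal (((2 ^ k * r) ^ (n + 1))⁻¹) :=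
              lintegral_mul_const' _ _ ENNReal.ofReal_ne_top
          _ ≤ ENNReal.ofReal ((1 + (k + 1 : ℕ) * 2 ^ n) * M * ((2 ^ (k + 1) * r) ^ n * om n)) * ENNReal.ofReal (((2 ^ k * r) ^ (n + 1))⁻¹) := by
              gcongr
              exact (lintegral_mono_set sdiff_subset).trans (bmo_big hn hf h x hr (k + 1))
          _ = _ := by
              rw [← ENNReal.ofReal_mul (by positivity)]
              congr 1
              simp only [u]
              have : (2 ^ (k + 1) * r : ℝ) = 2 * (2 ^ k * r) := by ring
              rw [this, mul_pow 2 (2 ^ k * r) n, one_div, inv_pow, pow_succ _ n]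
              field_simp
    _ = _ := by
        rw [← ENNReal.ofReal_tsum_of_nonneg (fun k => mul_nonneg (hu0 k).le (by positivity)) (hu.mul_right _), tsum_mul_right]
        congr 1; ring

lemma gauss_poly {t : ℝ} (ht : 0 < t) (x x0 y : EuclideanSpace ℝ (Fin n)) (N : ℕ) (hN : 1 ≤ N) :
    Real.exp (-‖x - y‖ ^ 2 / (4 * t)) * ‖y - x0‖ ^ N ≤ N ^ N * Real.exp (‖x - x0‖ + t) := by
  have hN0 : (0:ℝ) < N := by exact_mod_cast hN
  set v := ‖y - x0‖ with hv
  have e1 : v / N ≤ Real.exp (v / N) := by have := Real.add_one_le_exp (v / N); linarith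
  have e2 : v ^ N ≤ N ^ N * Real.exp v := by
    have := pow_le_pow_left₀ (by positivity) e1 N
    rw [← Real.exp_nat_mul, div_pow, div_le_iff₀ (by positivity), mul_div_cancel₀ _ hN0.ne'] at this
    linarith
  have e3 : v ≤ ‖x - x0‖ + ‖x - y‖ := by
    have : y - x0 = (x - x0) - (x - y) := by abel
    rw [hv, this]; exact norm_sub_le _ _
  have e4 : ‖x - y‖ - ‖x - y‖ ^ 2 / (4 * t) ≤ t := by
    rw [sub_le_iff_le_add, ← sub_le_iff_le_add', le_div_iff₀ (by positivity)]
    nlinarith [sq_nonneg (‖x - y‖ - 2 * t)]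
  calc _ ≤ Real.exp (-‖x - y‖ ^ 2 / (4 * t)) * (N ^ N * Real.exp v) := by gcongr
    _ = N ^ N * Real.exp (v + -‖x - y‖ ^ 2 / (4 * t)) := by rw [Real.exp_add]; ring
    _ ≤ _ := by
      apply mul_le_mul_of_nonneg_left _ (by positivity)
      rw [Real.exp_le_exp, neg_div]; linarith
end Part6

section Part7
variable {n : ℕ}

/-- the far part of `f` -/
def farP (f : EuclideanSpace ℝ (Fin n) → ℝ) (x0 : EuclideanSpace ℝ (Fin n)) (R : ℝ) : EuclideanSpace ℝ (Fin n) → ℝ :=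
  (Metric.ball x0 R)ᶜ.indicator (fun y => f y - avgOn f (Metric.ball x0 R))

lemma far_weight (hn : 1 ≤ n) : ∃ C > 0, ∀ (f : EuclideanSpace ℝ (Fin n) → ℝ) (M : ℝ),
    LocallyIntegrable f volume → IsBMOWith f M → ∀ (x0 : EuclideanSpace ℝ (Fin n)) (R : ℝ), 0 < R →
    Integrable (fun y => |farP f x0 R y| * (‖y - x0‖ ^ (n + 1))⁻¹) ∧
    ∫ y, |farP f x0 R y| * (‖y - x0‖ ^ (n + 1))⁻¹ ≤ C * M / R := by
  obtain ⟨C, hC, h⟩ := tail_bound hn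
  refine ⟨C, hC, ?_⟩
  intro f M hf hb x0 R hR
  have hM := bmo_nonneg hb
  have h1 := h f M hf hb x0 R hR
  have hm : AEStronglyMeasurable (fun y => |farP f x0 R y| * (‖y - x0‖ ^ (n + 1))⁻¹) := by
    apply AEStronglyMeasurable.mul
    · exact ((hf.aestronglyMeasurable.sub aestronglyMeasurable_const).indicator
        measurableSet_ball.compl).norm
    · exact (Measurable.aestronglyMeasurable (by fun_prop))
  have h0 : ∀ y, 0 ≤ |farP f x0 R y| * (‖y - x0‖ ^ (n + 1))⁻¹ := fun y => by positivity
  have h2 : ∫⁻ y, ENNReal.ofReal (|farP f x0 R y| * (‖y - x0‖ ^ (n + 1))⁻¹) ≤ ENNReal.ofReal (C * M / R) := by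
    refine le_trans (le_of_eq ?_) h1
    rw [← lintegral_indicator measurableSet_ball.compl]
    apply lintegral_congr
    intro y
    by_cases hy : y ∈ (Metric.ball x0 R)ᶜ
    · rw [indicator_of_mem hy, farP, indicator_of_mem hy]
    · rw [indicator_of_notMem hy, farP, indicator_of_notMem hy]; simp
  constructor
  · refine ⟨hm, ?_⟩
    rw [hasFiniteIntegral_iff_ofReal (ae_of_all _ h0)]
    exact h2.trans_lt ENNReal.ofReal_lt_top
  · rw [integral_eq_lintegral_of_nonneg_ae (ae_of_all _ h0) hm]
    exact ENNReal.toReal_le_of_le_ofReal (by positivity) h2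

lemma far_gauss (hn : 1 ≤ n) (f : EuclideanSpace ℝ (Fin n) → ℝ) (M : ℝ)
    (hf : LocallyIntegrable f volume) (hb : IsBMOWith f M) (x0 : EuclideanSpace ℝ (Fin n)) (R : ℝ) (hR : 0 < R)
    (x : EuclideanSpace ℝ (Fin n)) (t : ℝ) (ht : 0 < t) :
    Integrable (fun y => Real.exp (-‖x - y‖ ^ 2 / (4 * t)) * farP f x0 R y) := by
  obtain ⟨C, hC, h⟩ := far_weight hn
  obtain ⟨h1, -⟩ := h f M hf hb x0 R hR
  refine (h1.const_mul ((n + 1 : ℕ) ^ (n + 1) * Real.exp (‖x - x0‖ + t))).mono' ?_ ?_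
  · apply AEStronglyMeasurable.mul (Continuous.aestronglyMeasurable (by fun_prop))
    exact ((hf.aestronglyMeasurable.sub aestronglyMeasurable_const).indicator measurableSet_ball.compl)
  · refine ae_of_all _ fun y => ?_
    rw [norm_mul, Real.norm_of_nonneg (Real.exp_pos _).le, Real.norm_eq_abs]
    by_cases hy : y ∈ (Metric.ball x0 R)ᶜ
    · have hd : 0 < ‖y - x0‖ := by
        have := hy; rw [mem_compl_iff, mem_ball_iff_norm, not_lt] at this; linarith
      have hg := gauss_poly ht x x0 y (n + 1) (by omega)
      rw [← le_div_iff₀ (by positivity)] at hg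
      calc _ ≤ _ := mul_le_mul_of_nonneg_right hg (abs_nonneg _)
        _ = _ := by rw [div_eq_mul_inv]; ring
    · rw [farP, indicator_of_notMem hy]; simp

lemma far_var (hn : 1 ≤ n) {ρ : ℝ} (hρ : 1 ≤ ρ) : ∃ C > 0, ∀ (f : EuclideanSpace ℝ (Fin n) → ℝ) (M : ℝ),
    LocallyIntegrable f volume → IsBMOWith f M → ∀ (x0 : EuclideanSpace ℝ (Fin n)) (r : ℝ), 0 < r →
    ∀ x ∈ Metric.ball x0 r, ∀ x1 ∈ Metric.ball x0 r,
    eVar ρ (fun t => heatOp n t (farP f x0 (2 * r)) x - heatOp n t (farP f x0 (2 * r)) x1) ≤ ENNReal.ofReal (C * M) := by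
  obtain ⟨C, hC, h⟩ := far_weight hn
  obtain ⟨D, hD, hk⟩ := kq_var2 n
  refine ⟨D * C, by positivity, ?_⟩
  intro f M hf hb x0 r hr x hx x1 hx1
  have hM := bmo_nonneg hb
  obtain ⟨h1, h2⟩ := h f M hf hb x0 (2 * r) (by positivity)
  set g := farP f x0 (2 * r) with hg
  apply eVar_le_l1 hρ
  intro t ht J
  have hI : ∀ z : EuclideanSpace ℝ (Fin n), ∀ i, Integrable (fun y => kq n (t i) (‖z - y‖ ^ 2) * g y) := by
    intro z i
    refine ((far_gauss hn f M hf hb x0 (2 * r) (by positivity) z (t i) (ht.2.1 i)).const_mul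
      ((4 * Real.pi * t i) ^ (-(n : ℝ) / 2))).congr (ae_of_all _ fun y => ?_)
    simp only [kq, hg]; ring
  have hH : ∀ z : EuclideanSpace ℝ (Fin n), ∀ i, heatOp n (t i) g z = ∫ y, kq n (t i) (‖z - y‖ ^ 2) * g y := by
    intro z i
    rw [heatOp, ← integral_const_mul]
    congr 1; ext y
    simp only [kq]; ring
  let κ : ℕ → EuclideanSpace ℝ (Fin n) → ℝ := fun i y => (kq n (t i) (‖x - y‖ ^ 2) - kq n (t (i + 1)) (‖x - y‖ ^ 2))
      - (kq n (t i) (‖x1 - y‖ ^ 2) - kq n (t (i + 1)) (‖x1 - y‖ ^ 2))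
  have hκI : ∀ i, Integrable (fun y => κ i y * g y) := by
    intro i
    refine (((hI x i).sub (hI x (i + 1))).sub ((hI x1 i).sub (hI x1 (i + 1)))).congr (ae_of_all _ fun y => ?_)
    simp only [κ, Pi.sub_apply]; ring
  have hκ : ∀ i, heatOp n (t i) g x - heatOp n (t i) g x1 - (heatOp n (t (i + 1)) g x - heatOp n (t (i + 1)) g x1)
      = ∫ y, κ i y * g y := by
    intro i
    rw [hH, hH, hH, hH, ← integral_sub (hI _ _) (hI _ _), ← integral_sub (hI _ _) (hI _ _)]
    refine (integral_sub ((hI x i).sub (hI x1 i)) ((hI x (i + 1)).sub (hI x1 (i + 1)))).symm.trans ?_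
    congr 1; ext y
    simp only [κ, Pi.sub_apply]; ring
  calc _ = ∑ i ∈ Finset.range J, |∫ y, κ i y * g y| := Finset.sum_congr rfl fun i _ => by rw [hκ]
    _ ≤ ∑ i ∈ Finset.range J, ∫ y, |κ i y * g y| := Finset.sum_le_sum fun i _ => abs_integral_le_integral_abs
    _ = ∫ y, ∑ i ∈ Finset.range J, |κ i y * g y| := (integral_finsetSum _ fun i _ => (hκI i).abs).symm
    _ ≤ ∫ y, D * r * (|g y| * (‖y - x0‖ ^ (n + 1))⁻¹) := by
        apply integral_mono (integrable_finsetSum _ fun i _ => (hκI i).abs) (h1.const_mul _)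
        intro y
        simp only [abs_mul, ← Finset.sum_mul]
        by_cases hy : y ∈ Metric.ball x0 (2 * r)
        · have : g y = 0 := by
            rw [hg, farP, indicator_of_notMem (by simpa using hy)]
          simp [this]
        · calc _ ≤ _ := mul_le_mul_of_nonneg_right (hk x0 x x1 y r hr hx hx1 hy t ht J) (abs_nonneg _)
            _ = _ := by ring
    _ = D * r * ∫ y, |g y| * (‖y - x0‖ ^ (n + 1))⁻¹ := integral_const_mul _ _
    _ ≤ D * r * (C * M / (2 * r)) := by gcongr
    _ = D * C * M / 2 := by field_simp
    _ ≤ _ := by have : 0 ≤ D * C * M := by positivity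
                linarith
end Part7

section Part8
variable {n : ℕ}

/-- stopping level in the John-Nirenberg argument -/
def jnLam (n : ℕ) : ℝ := 2 * 8 ^ n * (1 + 2 ^ n) * 2 ^ n

/-- step length in the John-Nirenberg argument -/
def jnL (n : ℕ) : ℝ := jnLam n + 2 * 2 ^ n

lemma vol_cball (x : EuclideanSpace ℝ (Fin n)) {r : ℝ} (hr : 0 ≤ r) (hn : 1 ≤ n) :
    volume (Metric.closedBall x r) = ENNReal.ofReal (r ^ n * om n) := by
  have : NeZero n := ⟨by omega⟩
  rw [Measure.addHaar_closedBall_eq_addHaar_ball, vol_ball x hr hn]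

lemma jn_step {f : EuclideanSpace ℝ (Fin n) → ℝ} {M : ℝ} (hn : 1 ≤ n)
    (hf : LocallyIntegrable f volume) (h : IsBMOWith f M) (hM : 0 < M) (k : ℕ)
    (ih : ∀ (x : EuclideanSpace ℝ (Fin n)) (r : ℝ), 0 < r →
      volume {y ∈ Metric.ball x r | k * (jnL n * M) < |f y - avgOn f (Metric.ball x r)|}
        ≤ ENNReal.ofReal ((1 / 2) ^ k) * volume (Metric.ball x r))
    (x0 : EuclideanSpace ℝ (Fin n)) (R : ℝ) (hR : 0 < R) :
    volume {y ∈ Metric.ball x0 R | (k + 1 : ℕ) * (jnL n * M) < |f y - avgOn f (Metric.ball x0 R)|}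
      ≤ ENNReal.ofReal ((1 / 2) ^ (k + 1)) * volume (Metric.ball x0 R) := by
  have hom := om_pos (n := n)
  have hLam : 0 < jnLam n := by unfold jnLam; positivity
  have hL : 0 < jnL n := by unfold jnL; positivity
  set c := avgOn f (Metric.ball x0 R) with hc
  set E := {y ∈ Metric.ball x0 R | (k + 1 : ℕ) * (jnL n * M) < |f y - c|} with hE
  let s : ℕ → ℝ := fun j => R * (1 / 2) ^ j
  have hs0 : ∀ j, 0 < s j := fun j => by simp only [s]; positivity
  have hs1 : ∀ j, s j ≤ R := fun j => mul_le_of_le_one_right hR.le (pow_le_one₀ (by norm_num) (by norm_num))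
  have hsd : ∀ j, s j = 2 * s (j + 1) := fun j => by simp only [s]; rw [pow_succ]; ring
  let I : Set (EuclideanSpace ℝ (Fin n)) → ℝ≥0∞ := fun S => ∫⁻ y in S, ENNReal.ofReal |f y - c|
  let bad : EuclideanSpace ℝ (Fin n) → ℕ → Prop := fun x j =>
    ENNReal.ofReal (jnLam n * M) * volume (Metric.closedBall x (s j)) < I (Metric.closedBall x (s j))
  have hli : LocallyIntegrable (fun y => |f y - c|) volume := by
    intro x
    obtain ⟨S, hS, hi⟩ := (hf.sub (locallyIntegrable_const c)) x
    exact ⟨S, hS, hi.abs⟩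
  have hbig : I (Metric.ball x0 (2 * R)) ≤ ENNReal.ofReal ((1 + 2 ^ n) * M * ((2 * R) ^ n * om n)) := by
    have := bmo_big hn hf h x0 hR 1
    simpa using this
  have hsub : ∀ x ∈ Metric.ball x0 R, ∀ j, Metric.closedBall x (s j) ⊆ Metric.ball x0 (2 * R) := by
    intro x hx j y hy
    rw [Metric.mem_closedBall] at hy
    rw [Metric.mem_ball] at hx ⊢
    have := dist_triangle y x x0
    have := hs1 j
    linarith
  -- not bad at the top
  have htop : ∀ x ∈ Metric.ball x0 R, ¬ bad x 0 := by
    intro x hx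
    simp only [bad, not_lt]
    refine (lintegral_mono_set (hsub x hx 0)).trans (hbig.trans ?_)
    rw [vol_cball x (hs0 0).le hn, ← ENNReal.ofReal_mul (by positivity)]
    apply ENNReal.ofReal_le_ofReal
    have : s 0 = R := by simp [s]
    rw [this, mul_pow, jnLam]
    have h8 : (1:ℝ) ≤ 2 * 8 ^ n := by
      have : (1:ℝ) ≤ 8 ^ n := one_le_pow₀ (by norm_num)
      linarith
    calc (1 + 2 ^ n) * M * (2 ^ n * R ^ n * om n) = 1 * ((1 + 2 ^ n) * 2 ^ n * M * (R ^ n * om n)) := by ring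
      _ ≤ (2 * 8 ^ n) * ((1 + 2 ^ n) * 2 ^ n * M * (R ^ n * om n)) := by gcongr
      _ = _ := by ring
  -- bad eventually, almost everywhere
  have hae : ∀ᵐ x : EuclideanSpace ℝ (Fin n), x ∈ E → ∃ j, bad x j := by
    filter_upwards [IsUnifLocDoublingMeasure.ae_tendsto_average (volume : Measure (EuclideanSpace ℝ (Fin n))) hli 1] with x hx hxE
    have hδ : Tendsto s atTop (nhdsWithin 0 (Ioi 0)) := by
      rw [tendsto_nhdsWithin_iff]
      refine ⟨?_, Eventually.of_forall hs0⟩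
      have := (tendsto_pow_atTop_nhds_zero_of_lt_one (r := (1/2:ℝ)) (by norm_num) (by norm_num)).const_mul R
      simpa [s] using this
    have h1 := hx (fun _ : ℕ => x) s hδ (Eventually.of_forall fun j => by
      simpa using (hs0 j).le)
    have hgt : jnLam n * M < |f x - c| := by
      refine lt_of_le_of_lt ?_ hxE.2
      push_cast
      have : jnLam n * M ≤ jnL n * M := by
        apply mul_le_mul_of_nonneg_right _ hM.le
        unfold jnL
        have : (0:ℝ) < 2 * 2 ^ n := by positivity
        linarith
      have h2 : 0 ≤ k * (jnL n * M) := by positivity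
      linarith
    obtain ⟨j, hj⟩ := (h1.eventually (lt_mem_nhds hgt)).exists
    refine ⟨j, ?_⟩
    simp only [bad, I]
    have hIntOn : IntegrableOn (fun y => |f y - c|) (Metric.closedBall x (s j)) :=
      hli.integrableOn_isCompact (isCompact_closedBall _ _)
    rw [← ofReal_integral_eq_lintegral_ofReal hIntOn (ae_of_all _ fun _ => abs_nonneg _),
      vol_cball x (hs0 j).le hn, ← ENNReal.ofReal_mul (by positivity)]
    have hv : 0 < s j ^ n * om n := mul_pos (pow_pos (hs0 j) n) hom
    rw [setAverage_eq, Measure.real, vol_cball x (hs0 j).le hn, ENNReal.toReal_ofReal hv.le, smul_eq_mul,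
      ← div_eq_inv_mul, lt_div_iff₀ hv] at hj
    rw [ENNReal.ofReal_lt_ofReal_iff (lt_trans (by positivity) hj)]
    exact hj
  classical
  let E' := {x ∈ E | ∃ j, bad x j}
  have hEE' : volume E ≤ volume E' := by
    apply measure_mono_ae
    filter_upwards [hae] with x hx hxE
    exact ⟨hxE, hx hxE⟩
  have hsel : ∀ x, ∃ j, x ∈ E' → bad x (j + 1) ∧ ¬ bad x j := by
    intro x
    by_cases hx : x ∈ E'
    · have hex := hx.2
      have hne : Nat.find hex ≠ 0 := by
        intro h0
        have := Nat.find_spec hex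
        rw [h0] at this
        exact htop x hx.1.1 this
      obtain ⟨j, hj⟩ := Nat.exists_eq_succ_of_ne_zero hne
      refine ⟨j, fun _ => ⟨?_, Nat.find_min hex (by omega)⟩⟩
      have := Nat.find_spec hex
      rwa [hj] at this
    · exact ⟨0, fun h => absurd h hx⟩
  choose J hJ using hsel
  let rr : EuclideanSpace ℝ (Fin n) → ℝ := fun x => s (J x + 1)
  have hrr : ∀ x, 0 < rr x := fun x => hs0 _
  obtain ⟨u, hut, hdis, hcov⟩ := Vitali.exists_disjoint_subfamily_covering_enlargement_closedBall E'
    (fun x : EuclideanSpace ℝ (Fin n) => x) rr R (fun x _ => hs1 _) 5 (by norm_num)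
  have hucount : u.Countable := by
    apply hdis.countable_of_nonempty_interior
    intro x _
    exact ⟨x, Metric.ball_subset_interior_closedBall (Metric.mem_ball_self (hrr x))⟩
  have hE'sub : E' ⊆ ⋃ x ∈ u, (E ∩ Metric.ball x (2 ^ 2 * (2 * rr x))) := by
    intro y hy
    obtain ⟨x, hxu, hx⟩ := hcov y hy
    rw [mem_iUnion₂]
    refine ⟨x, hxu, hy.1, ?_⟩
    have := hx (Metric.mem_closedBall_self (hrr y).le)
    rw [Metric.mem_closedBall] at this
    rw [Metric.mem_ball]
    have := hrr x
    linarith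
  -- estimate on each ball
  have hone : ∀ x ∈ u, volume (E ∩ Metric.ball x (2 ^ 2 * (2 * rr x)))
      ≤ ENNReal.ofReal ((1 / 2) ^ k) * ENNReal.ofReal (8 ^ n * (jnLam n * M)⁻¹) * I (Metric.closedBall x (rr x)) := by
    intro x hxu
    obtain ⟨hb1, hb2⟩ := hJ x (hut hxu)
    have hx0 := hrr x
    have e1 : |avgOn f (Metric.ball x (2 * rr x)) - c| ≤ jnLam n * M := by
      have h1 := avg_sub_le (li_ball hf x (2 * rr x)) measure_ball_lt_top.ne
        (Metric.measure_ball_pos volume x (by positivity : 0 < 2 * rr x)).ne' c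
      refine h1.trans ?_
      have hv : 0 < (2 * rr x) ^ n * om n := by positivity
      rw [vol_ball' x (by positivity) hn, inv_mul_le_iff₀ hv]
      simp only [bad, not_lt, I] at hb2
      rw [hsd (J x), vol_cball x (by positivity) hn] at hb2
      have hI := (intOn_sub (li_ball hf x (2 * rr x)) measure_ball_lt_top.ne c)
      have h3 : ENNReal.ofReal (∫ y in Metric.ball x (2 * rr x), |f y - c|)
          ≤ ENNReal.ofReal ((2 * rr x) ^ n * om n * (jnLam n * M)) := by
        rw [ofReal_integral_eq_lintegral_ofReal hI (ae_of_all _ fun _ => abs_nonneg _)]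
        refine (lintegral_mono_set Metric.ball_subset_closedBall).trans (hb2.trans (le_of_eq ?_))
        rw [← ENNReal.ofReal_mul (by positivity), mul_comm]
      exact (ENNReal.ofReal_le_ofReal_iff (by positivity)).1 h3
    have e2 := bmo_shift hn hf h x (r := 2 * rr x) (by positivity) 2
    have e3 : |avgOn f (Metric.ball x (2 ^ 2 * (2 * rr x))) - c| ≤ jnL n * M := by
      have := abs_sub_le (avgOn f (Metric.ball x (2 ^ 2 * (2 * rr x)))) (avgOn f (Metric.ball x (2 * rr x))) c
      unfold jnL
      push_cast at e2
      rw [add_mul]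
      linarith
    have hsubE : E ∩ Metric.ball x (2 ^ 2 * (2 * rr x)) ⊆ {y ∈ Metric.ball x (2 ^ 2 * (2 * rr x)) |
        k * (jnL n * M) < |f y - avgOn f (Metric.ball x (2 ^ 2 * (2 * rr x)))|} := by
      rintro y ⟨hyE, hyB⟩
      refine ⟨hyB, ?_⟩
      have h1 := hyE.2
      push_cast at h1
      have := abs_sub_le (f y) (avgOn f (Metric.ball x (2 ^ 2 * (2 * rr x)))) c
      linarith
    refine (measure_mono hsubE).trans ((ih x _ (by positivity)).trans ?_)
    rw [mul_assoc]
    gcongr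
    have h5 : volume (Metric.closedBall x (rr x)) ≤ ENNReal.ofReal ((jnLam n * M)⁻¹) * I (Metric.closedBall x (rr x)) := by
      have : ENNReal.ofReal ((jnLam n * M)⁻¹) * (ENNReal.ofReal (jnLam n * M) * volume (Metric.closedBall x (rr x)))
          = volume (Metric.closedBall x (rr x)) := by
        rw [← mul_assoc, ← ENNReal.ofReal_mul (by positivity), inv_mul_cancel₀ (by positivity)]; simp
      rw [← this]
      gcongr
    calc volume (Metric.ball x (2 ^ 2 * (2 * rr x))) = ENNReal.ofReal (8 ^ n) * volume (Metric.closedBall x (rr x)) := by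
          rw [vol_ball x (by positivity) hn, vol_cball x hx0.le hn, ← ENNReal.ofReal_mul (by positivity)]
          congr 1
          have e8 : ∀ z : ℝ, (2 ^ 2 * (2 * z)) ^ n = 8 ^ n * z ^ n := by
            intro z; rw [← mul_pow]; congr 1; ring
          rw [e8, mul_assoc]
      _ ≤ ENNReal.ofReal (8 ^ n) * (ENNReal.ofReal ((jnLam n * M)⁻¹) * I (Metric.closedBall x (rr x))) := by gcongr
      _ = _ := by rw [← mul_assoc, ← ENNReal.ofReal_mul (by positivity)]
  calc volume E ≤ volume E' := hEE'
    _ ≤ ∑' x : u, volume (E ∩ Metric.ball x.1 (2 ^ 2 * (2 * rr x.1))) :=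
        (measure_mono hE'sub).trans (measure_biUnion_le _ hucount _)
    _ ≤ ∑' x : u, ENNReal.ofReal ((1 / 2) ^ k) * ENNReal.ofReal (8 ^ n * (jnLam n * M)⁻¹) * I (Metric.closedBall x.1 (rr x.1)) :=
        ENNReal.tsum_le_tsum fun x => hone x.1 x.2
    _ = ENNReal.ofReal ((1 / 2) ^ k) * ENNReal.ofReal (8 ^ n * (jnLam n * M)⁻¹) * ∑' x : u, I (Metric.closedBall x.1 (rr x.1)) :=
        ENNReal.tsum_mul_left
    _ ≤ ENNReal.ofReal ((1 / 2) ^ k) * ENNReal.ofReal (8 ^ n * (jnLam n * M)⁻¹) *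
          ENNReal.ofReal ((1 + 2 ^ n) * M * ((2 * R) ^ n * om n)) := by
        gcongr
        have := lintegral_biUnion (μ := volume) hucount (fun x _ => Metric.isClosed_closedBall.measurableSet) hdis (fun y => ENNReal.ofReal |f y - c|)
        refine (le_of_eq this.symm).trans (le_trans (lintegral_mono_set ?_) hbig)
        apply iUnion₂_subset
        intro x hx
        exact hsub x (hut hx).1.1 _
    _ = _ := by
        rw [vol_ball x0 hR.le hn, ← ENNReal.ofReal_mul (by positivity), ← ENNReal.ofReal_mul (by positivity),
          ← ENNReal.ofReal_mul (by positivity)]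
        congr 1
        rw [jnLam, mul_pow, pow_succ]
        field_simp

lemma jn_exp {f : EuclideanSpace ℝ (Fin n) → ℝ} {M : ℝ} (hn : 1 ≤ n)
    (hf : LocallyIntegrable f volume) (h : IsBMOWith f M) (hM : 0 < M) (k : ℕ) :
    ∀ (x : EuclideanSpace ℝ (Fin n)) (r : ℝ), 0 < r →
      volume {y ∈ Metric.ball x r | k * (jnL n * M) < |f y - avgOn f (Metric.ball x r)|}
        ≤ ENNReal.ofReal ((1 / 2) ^ k) * volume (Metric.ball x r) := by
  induction k with
  | zero =>
    intro x r hr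
    simp only [pow_zero, ENNReal.ofReal_one, one_mul]
    exact measure_mono fun y hy => hy.1
  | succ k ih => exact fun x r hr => jn_step hn hf h hM k ih x r hr

lemma jn_sq (hn : 1 ≤ n) : ∃ A > 0, ∀ (f : EuclideanSpace ℝ (Fin n) → ℝ) (M : ℝ), Measurable f →
    LocallyIntegrable f volume → IsBMOWith f M → 0 < M → ∀ (x : EuclideanSpace ℝ (Fin n)) (r : ℝ), 0 < r →
    ∫⁻ y in Metric.ball x r, ENNReal.ofReal ((f y - avgOn f (Metric.ball x r)) ^ 2)
      ≤ ENNReal.ofReal (A * M ^ 2) * volume (Metric.ball x r) := by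
  have hL : 0 < jnL n := by unfold jnL jnLam; positivity
  let u : ℕ → ℝ := fun k => ((k + 1 : ℕ) : ℝ) ^ 2 * (1 / 2) ^ k
  have hu : Summable u := by
    have := (summable_nat_add_iff 1).2 (summable_pow_mul_geometric_of_norm_lt_one (R := ℝ) 2 (r := 1 / 2) (by norm_num))
    refine (this.mul_left 2).congr fun k => ?_
    simp only [u]; rw [pow_succ (1 / 2 : ℝ)]; ring
  have hu0 : ∀ k, 0 < u k := fun k => by simp only [u]; positivity
  refine ⟨jnL n ^ 2 * ∑' k, u k, mul_pos (by positivity) (hu.tsum_pos (fun k => (hu0 k).le) 0 (hu0 0)), ?_⟩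
  intro f M hfm hf h hM x r hr
  set c := avgOn f (Metric.ball x r) with hc
  let E : ℕ → Set (EuclideanSpace ℝ (Fin n)) := fun k => {y | k * (jnL n * M) < |f y - c|}
  have hEm : ∀ k, MeasurableSet (E k) := fun k => measurableSet_lt measurable_const (by fun_prop)
  have hLM : 0 < jnL n * M := by positivity
  have hpt : ∀ y, ENNReal.ofReal ((f y - c) ^ 2) ≤
      ∑' k, (E k).indicator (fun _ => ENNReal.ofReal (((k + 1 : ℕ) * (jnL n * M)) ^ 2)) y := by
    intro y
    by_cases hv : |f y - c| = 0
    · rw [abs_eq_zero] at hv; rw [hv]; simp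
    have hv0 : 0 < |f y - c| := lt_of_le_of_ne (abs_nonneg _) (Ne.symm hv)
    have hpos : 0 < ⌈|f y - c| / (jnL n * M)⌉₊ := Nat.ceil_pos.2 (by positivity)
    obtain ⟨k, hk⟩ := Nat.exists_eq_succ_of_ne_zero hpos.ne'
    refine le_trans ?_ (ENNReal.le_tsum k)
    have hyk : y ∈ E k := by
      have : (k : ℝ) < |f y - c| / (jnL n * M) := Nat.lt_ceil.1 (by omega)
      rwa [lt_div_iff₀ hLM] at this
    rw [indicator_of_mem hyk]
    apply ENNReal.ofReal_le_ofReal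
    rw [← sq_abs]
    apply pow_le_pow_left₀ (abs_nonneg _)
    have := Nat.le_ceil (|f y - c| / (jnL n * M))
    rwa [hk, div_le_iff₀ hLM] at this
  calc _ ≤ ∫⁻ y in Metric.ball x r, ∑' k, (E k).indicator (fun _ => ENNReal.ofReal (((k + 1 : ℕ) * (jnL n * M)) ^ 2)) y :=
        lintegral_mono hpt
    _ = ∑' k, ∫⁻ y in Metric.ball x r, (E k).indicator (fun _ => ENNReal.ofReal (((k + 1 : ℕ) * (jnL n * M)) ^ 2)) y :=
        lintegral_tsum fun k => (measurable_const.indicator (hEm k)).aemeasurable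
    _ ≤ ∑' k, ENNReal.ofReal (u k * (jnL n * M) ^ 2) * volume (Metric.ball x r) := by
        apply ENNReal.tsum_le_tsum
        intro k
        rw [lintegral_indicator (hEm k), setLIntegral_const, Measure.restrict_apply (hEm k)]
        have h1 := jn_exp hn hf h hM k x r hr
        have : E k ∩ Metric.ball x r = {y ∈ Metric.ball x r | k * (jnL n * M) < |f y - c|} := by
          ext y; simp only [E, mem_inter_iff, mem_ofPred_eq]; tauto
        rw [this]
        calc _ ≤ ENNReal.ofReal (((k + 1 : ℕ) * (jnL n * M)) ^ 2) * (ENNReal.ofReal ((1 / 2) ^ k) * volume (Metric.ball x r)) := by gcongr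
          _ = _ := by
            rw [← mul_assoc, ← ENNReal.ofReal_mul (by positivity)]
            congr 2
            simp only [u]; ring
    _ = _ := by
        rw [ENNReal.tsum_mul_right, ← ENNReal.ofReal_tsum_of_nonneg (fun k => mul_nonneg (hu0 k).le (by positivity)) (hu.mul_right _),
          tsum_mul_right]
        congr 2; ring
end Part8

section Part9
variable {n : ℕ}

/-- the local part of `f` -/
def nearP (f : EuclideanSpace ℝ (Fin n) → ℝ) (x0 : EuclideanSpace ℝ (Fin n)) (R : ℝ) : EuclideanSpace ℝ (Fin n) → ℝ :=
  (Metric.ball x0 R).indicator (fun y => f y - avgOn f (Metric.ball x0 R))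

lemma near_int {f : EuclideanSpace ℝ (Fin n) → ℝ} (hf : LocallyIntegrable f volume)
    (x0 : EuclideanSpace ℝ (Fin n)) (R : ℝ) : Integrable (nearP f x0 R) := by
  unfold nearP
  rw [integrable_indicator_iff measurableSet_ball]
  exact (li_ball hf x0 R).sub (integrableOn_const measure_ball_lt_top.ne)

lemma heat_split (hn : 1 ≤ n) (f : EuclideanSpace ℝ (Fin n) → ℝ) (M : ℝ)
    (hf : LocallyIntegrable f volume) (hb : IsBMOWith f M) (x0 : EuclideanSpace ℝ (Fin n)) (R : ℝ) (hR : 0 < R)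
    (x : EuclideanSpace ℝ (Fin n)) (t : ℝ) (ht : 0 < t) :
    heatOp n t f x = heatOp n t (nearP f x0 R) x + heatOp n t (farP f x0 R) x + avgOn f (Metric.ball x0 R) := by
  set c := avgOn f (Metric.ball x0 R) with hc
  have hconst : heatOp n t (fun _ => c) x = c := by
    have := gam_prob (n := n) ht
    rw [heatOp_eq ht]; simp
  have i0 : Integrable (fun y => Real.exp (-‖x - y‖ ^ 2 / (4 * t))) := by
    have h1 := (hker_integral (n := n) ht).1.comp_sub_left x
    refine (h1.const_mul ((4 * Real.pi * t) ^ (-(n : ℝ) / 2))⁻¹).congr (ae_of_all _ fun y => ?_)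
    have : (4 * Real.pi * t) ^ (-(n : ℝ) / 2) ≠ 0 := by positivity
    simp only [hker]
    rw [inv_mul_cancel_left₀ this]
  have i1 : Integrable (fun y => Real.exp (-‖x - y‖ ^ 2 / (4 * t)) * nearP f x0 R y) := by
    apply (near_int hf x0 R).bdd_mul (c := 1) (Continuous.aestronglyMeasurable (by fun_prop))
    refine ae_of_all _ fun y => ?_
    rw [Real.norm_of_nonneg (Real.exp_pos _).le, Real.exp_le_one_iff]
    exact div_nonpos_of_nonpos_of_nonneg (by simp) (by positivity)
  have i2 := far_gauss hn f M hf hb x0 R hR x t ht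
  have i3 : Integrable (fun y => Real.exp (-‖x - y‖ ^ 2 / (4 * t)) * c) := i0.mul_const c
  conv_rhs => rw [← hconst]
  unfold heatOp
  rw [← mul_add, ← mul_add, ← integral_add i1 i2]
  congr 1
  refine Eq.trans ?_ (integral_add (i1.add i2) i3)
  congr 1
  ext y
  simp only [Pi.add_apply]
  rw [← mul_add, ← mul_add]
  congr 1
  by_cases hy : y ∈ Metric.ball x0 R
  · rw [nearP, farP, indicator_of_mem hy, indicator_of_notMem (by simpa using hy)]; ring
  · rw [nearP, farP, indicator_of_notMem hy, indicator_of_mem (by simpa using hy)]; ring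

lemma abs_toReal_le {a b d : ℝ≥0∞} (hb : b ≠ ⊤) (h1 : a ≤ b + d) (h2 : b ≤ a + d) :
    ENNReal.ofReal |a.toReal - b.toReal| ≤ d := by
  by_cases hd : d = ⊤
  · rw [hd]; exact le_top
  have ha : a ≠ ⊤ := ne_top_of_le_ne_top (ENNReal.add_ne_top.2 ⟨hb, hd⟩) h1
  apply ENNReal.ofReal_le_of_le_toReal
  have e1 := ENNReal.toReal_mono (ENNReal.add_ne_top.2 ⟨hb, hd⟩) h1
  have e2 := ENNReal.toReal_mono (ENNReal.add_ne_top.2 ⟨ha, hd⟩) h2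
  rw [ENNReal.toReal_add hb hd] at e1
  rw [ENNReal.toReal_add ha hd] at e2
  rw [abs_le]; constructor <;> linarith

lemma core_bmo (hn : 1 ≤ n) {ρ : ℝ} (hρ : 2 < ρ) :
    ∃ C > 0, ∀ (f : EuclideanSpace ℝ (Fin n) → ℝ) (M : ℝ), Measurable f →
      LocallyIntegrable f volume → IsBMOWith f M →
      (∀ᵐ x : EuclideanSpace ℝ (Fin n), eVar ρ (fun t => heatOp n t f x) ≠ ⊤) →
      ∀ (x₀ : EuclideanSpace ℝ (Fin n)) (r₀ : ℝ), 0 < r₀ → ∃ cB : ℝ,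
        ∫⁻ x in Metric.ball x₀ r₀,
            ENNReal.ofReal |(eVar ρ (fun t => heatOp n t f x)).toReal - cB|
          ≤ ENNReal.ofReal (C * M) * volume (Metric.ball x₀ r₀) := by
  have hρ1 : 1 ≤ ρ := by linarith
  obtain ⟨A, hA, hjn⟩ := jn_sq hn
  obtain ⟨D, hD, hloc⟩ := local_bound (n := n) hρ
  obtain ⟨F, hF, hfar⟩ := far_var hn hρ1
  refine ⟨(1 + D * (A * 2 ^ n)) + F, by positivity, ?_⟩
  intro f M hfm hf hb hfin x₀ r hr
  have hM := bmo_nonneg hb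
  have hom := om_pos (n := n)
  set f1 := nearP f x₀ (2 * r) with hf1
  set f2 := farP f x₀ (2 * r) with hf2
  have h2r : 0 < 2 * r := by positivity
  have hf1m : Measurable f1 := (hfm.sub measurable_const).indicator measurableSet_ball
  have hf1i : Integrable f1 := near_int hf x₀ _
  have hvB : volume (Metric.ball x₀ r) ≠ ⊤ := measure_ball_lt_top.ne
  have hsq : ∀ T, M ≤ T → 0 < T →
      ∫⁻ x, ENNReal.ofReal (f1 x ^ 2) ≤ ENNReal.ofReal (A * 2 ^ n * T ^ 2) * volume (Metric.ball x₀ r) := by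
    intro T hT hT0
    have hbT : IsBMOWith f T := fun x s hs => (hb x s hs).trans hT
    have h1 := hjn f T hfm hf hbT hT0 x₀ (2 * r) h2r
    have h2 : ∫⁻ x, ENNReal.ofReal (f1 x ^ 2)
        = ∫⁻ y in Metric.ball x₀ (2 * r), ENNReal.ofReal ((f y - avgOn f (Metric.ball x₀ (2 * r))) ^ 2) := by
      rw [← lintegral_indicator measurableSet_ball]
      apply lintegral_congr
      intro y
      by_cases hy : y ∈ Metric.ball x₀ (2 * r)
      · rw [indicator_of_mem hy, hf1, nearP, indicator_of_mem hy]
      · rw [indicator_of_notMem hy, hf1, nearP, indicator_of_notMem hy]; simp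
    rw [h2]
    refine h1.trans (le_of_eq ?_)
    rw [vol_ball x₀ h2r.le hn, vol_ball x₀ hr.le hn, ← ENNReal.ofReal_mul (by positivity),
      ← ENNReal.ofReal_mul (by positivity), mul_pow]
    congr 1; ring
  have hg : ∀ T, M ≤ T → 0 < T → ∃ g : EuclideanSpace ℝ (Fin n) → ℝ≥0∞, Measurable g ∧
      (∀ x, eVar ρ (fun t => heatOp n t f1 x) ≤ g x) ∧
      ∫⁻ x in Metric.ball x₀ r, g x ≤ ENNReal.ofReal (T * (1 + D * (A * 2 ^ n))) * volume (Metric.ball x₀ r) := by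
    intro T hT hT0
    obtain ⟨g, hgm, hg1, hg2⟩ := hloc f1 hf1m hf1i T hT0 (Metric.ball x₀ r)
    refine ⟨g, hgm, hg1, hg2.trans ?_⟩
    calc _ ≤ ENNReal.ofReal T * (volume (Metric.ball x₀ r) + ENNReal.ofReal D * (ENNReal.ofReal (T ^ 2)⁻¹ *
          (ENNReal.ofReal (A * 2 ^ n * T ^ 2) * volume (Metric.ball x₀ r)))) := by
          gcongr; exact hsq T hT hT0
      _ = _ := by
          rw [vol_ball x₀ hr.le hn, ← ENNReal.ofReal_mul (by positivity), ← ENNReal.ofReal_mul (by positivity),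
            ← ENNReal.ofReal_mul (by positivity), ← ENNReal.ofReal_add (by positivity) (by positivity),
            ← ENNReal.ofReal_mul (by positivity), ← ENNReal.ofReal_mul (by positivity)]
          congr 1
          field_simp
  -- variation inequalities
  have hv1 : ∀ x, eVar ρ (fun t => heatOp n t f x) ≤ eVar ρ (fun t => heatOp n t f1 x) + eVar ρ (fun t => heatOp n t f2 x) := by
    intro x
    refine le_trans (le_of_eq (eVar_congr ?_)) (eVar_add hρ1 _ _)
    intro t s ht hs
    rw [heat_split hn f M hf hb x₀ (2 * r) h2r x t ht, heat_split hn f M hf hb x₀ (2 * r) h2r x s hs]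
    congr 1; ring
  have hv2 : ∀ x, eVar ρ (fun t => heatOp n t f2 x) ≤ eVar ρ (fun t => heatOp n t f x) + eVar ρ (fun t => heatOp n t f1 x) := by
    intro x
    have e : eVar ρ (fun t => heatOp n t f1 x) = eVar ρ (fun t => -heatOp n t f1 x) :=
      eVar_congr fun t s _ _ => by rw [neg_sub_neg, abs_sub_comm]
    rw [e]
    refine le_trans (le_of_eq (eVar_congr ?_)) (eVar_add hρ1 _ _)
    intro t s ht hs
    rw [heat_split hn f M hf hb x₀ (2 * r) h2r x t ht, heat_split hn f M hf hb x₀ (2 * r) h2r x s hs]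
    congr 1; ring
  have hv3 : ∀ x ∈ Metric.ball x₀ r, ∀ x1 ∈ Metric.ball x₀ r,
      eVar ρ (fun t => heatOp n t f2 x) ≤ eVar ρ (fun t => heatOp n t f2 x1) + ENNReal.ofReal (F * M) := by
    intro x hx x1 hx1
    refine le_trans (le_trans (le_of_eq (eVar_congr ?_)) (eVar_add hρ1 (fun t => heatOp n t f2 x1)
      (fun t => heatOp n t f2 x - heatOp n t f2 x1))) (add_le_add le_rfl (hfar f M hf hb x₀ r hr x hx x1 hx1))
    intro t s ht hs
    congr 1; ring
  obtain ⟨x1, hx1B, hx1f, hx1f1⟩ : ∃ x1 ∈ Metric.ball x₀ r, eVar ρ (fun t => heatOp n t f x1) ≠ ⊤ ∧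
      eVar ρ (fun t => heatOp n t f1 x1) ≠ ⊤ := by
    obtain ⟨g, hgm, hg1, hg2⟩ := hg (M + 1) (by linarith) (by linarith)
    have hlt : ∫⁻ x in Metric.ball x₀ r, g x ≠ ⊤ := by
      refine ne_top_of_le_ne_top ?_ hg2
      exact ENNReal.mul_ne_top ENNReal.ofReal_ne_top hvB
    have h1 := ae_lt_top hgm hlt
    have h2 := ae_restrict_of_ae (s := Metric.ball x₀ r) hfin
    have h3 := ae_restrict_mem (μ := (volume : Measure (EuclideanSpace ℝ (Fin n)))) (measurableSet_ball (x := x₀) (ε := r))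
    have hne : (ae (volume.restrict (Metric.ball x₀ r))).NeBot := by
      rw [ae_neBot, Ne, Measure.restrict_eq_zero]
      exact (Metric.measure_ball_pos volume x₀ hr).ne'
    obtain ⟨x, hx1, hx2, hx3⟩ := (h1.and (h2.and h3)).exists
    exact ⟨x, hx3, hx2, ne_top_of_le_ne_top hx1.ne (hg1 x)⟩
  have hV2 : eVar ρ (fun t => heatOp n t f2 x1) ≠ ⊤ :=
    ne_top_of_le_ne_top (ENNReal.add_ne_top.2 ⟨hx1f, hx1f1⟩) (hv2 x1)
  refine ⟨(eVar ρ (fun t => heatOp n t f2 x1)).toReal, ?_⟩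
  have hpt : ∀ x ∈ Metric.ball x₀ r, ENNReal.ofReal |(eVar ρ (fun t => heatOp n t f x)).toReal -
      (eVar ρ (fun t => heatOp n t f2 x1)).toReal| ≤ eVar ρ (fun t => heatOp n t f1 x) + ENNReal.ofReal (F * M) := by
    intro x hx
    apply abs_toReal_le hV2
    · calc _ ≤ _ := hv1 x
        _ ≤ eVar ρ (fun t => heatOp n t f1 x) + (eVar ρ (fun t => heatOp n t f2 x1) + ENNReal.ofReal (F * M)) := by
          gcongr; exact hv3 x hx x1 hx1B
        _ = _ := by rw [← add_assoc, ← add_assoc, add_comm (eVar ρ (fun t => heatOp n t f1 x))]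
    · calc _ ≤ _ := hv3 x1 hx1B x hx
        _ ≤ (eVar ρ (fun t => heatOp n t f x) + eVar ρ (fun t => heatOp n t f1 x)) + ENNReal.ofReal (F * M) := by
          gcongr; exact hv2 x
        _ = _ := by rw [add_assoc]
  set K := 1 + D * (A * 2 ^ n) with hK
  have hT : ∀ T, M < T → ∫⁻ x in Metric.ball x₀ r, ENNReal.ofReal |(eVar ρ (fun t => heatOp n t f x)).toReal -
      (eVar ρ (fun t => heatOp n t f2 x1)).toReal| ≤ ENNReal.ofReal (T * K + F * M) * volume (Metric.ball x₀ r) := by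
    intro T hMT
    have hT0 : 0 < T := by linarith
    obtain ⟨g, hgm, hg1, hg2⟩ := hg T hMT.le hT0
    calc _ ≤ ∫⁻ x in Metric.ball x₀ r, (g x + ENNReal.ofReal (F * M)) := by
          apply setLIntegral_mono' measurableSet_ball
          intro x hx
          exact (hpt x hx).trans (add_le_add (hg1 x) le_rfl)
      _ = (∫⁻ x in Metric.ball x₀ r, g x) + ENNReal.ofReal (F * M) * volume (Metric.ball x₀ r) := by
          rw [lintegral_add_left hgm, setLIntegral_const]
      _ ≤ ENNReal.ofReal (T * K) * volume (Metric.ball x₀ r) + ENNReal.ofReal (F * M) * volume (Metric.ball x₀ r) := by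
          gcongr
      _ = _ := by rw [← add_mul, ← ENNReal.ofReal_add (by positivity) (by positivity)]
  have hlim : Tendsto (fun T : ℝ => ENNReal.ofReal (T * K + F * M) * volume (Metric.ball x₀ r)) (nhdsWithin M (Ioi M))
      (nhds (ENNReal.ofReal (M * K + F * M) * volume (Metric.ball x₀ r))) := by
    apply ENNReal.Tendsto.mul_const _ (Or.inr hvB)
    apply ENNReal.tendsto_ofReal
    have : Continuous fun T : ℝ => T * K + F * M := by fun_prop
    exact (this.tendsto M).mono_left nhdsWithin_le_nhds
  have e : (K + F) * M = M * K + F * M := by ring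
  rw [e]
  refine ge_of_tendsto hlim ?_
  filter_upwards [self_mem_nhdsWithin] with T hMT
  exact hT T hMT
end Part9

/-- let `ρ > 2`. If `f ∈ BMO(ℝⁿ)` (with norm at most `M`) and the
`ρ`-variation `V_ρ(W_t)(f)(x)` of the heat semigroup is finite a.e., then
`V_ρ(W_t)(f) ∈ BMO(ℝⁿ)` with `‖V_ρ(W_t)(f)‖_{BMO} ≤ C M`, `C` independent of `f`:
over every ball there is a constant `c_B` such that the mean deviation of
`V_ρ(W_t)(f)` from `c_B` is at most `C M`. -/
theorem variation_heat_bmo (n : ℕ) (hn : 1 ≤ n) (ρ : ℝ) (hρ : 2 < ρ) :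
    ∃ C > 0, ∀ (f : EuclideanSpace ℝ (Fin n) → ℝ) (M : ℝ),
      LocallyIntegrable f volume → IsBMOWith f M →
      (∀ᵐ x : EuclideanSpace ℝ (Fin n), eVar ρ (fun t => heatOp n t f x) ≠ ⊤) →
      ∀ (x₀ : EuclideanSpace ℝ (Fin n)) (r₀ : ℝ), 0 < r₀ → ∃ cB : ℝ,
        ∫⁻ x in Metric.ball x₀ r₀,
            ENNReal.ofReal |(eVar ρ (fun t => heatOp n t f x)).toReal - cB|
          ≤ ENNReal.ofReal (C * M) * volume (Metric.ball x₀ r₀) := by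
  obtain ⟨C, hC, h⟩ := core_bmo hn hρ
  refine ⟨C, hC, ?_⟩
  intro f M hf hb hfin x₀ r₀ hr₀
  obtain ⟨f', hf'm, hff'⟩ := hf.aestronglyMeasurable
  have hheat : ∀ t x, heatOp n t f x = heatOp n t f' x := by
    intro t x
    unfold heatOp
    congr 1
    apply integral_congr_ae
    filter_upwards [hff'] with y hy
    rw [hy]
  have havg : ∀ S, avgOn f S = avgOn f' S := by
    intro S
    unfold avgOn
    congr 1
    exact integral_congr_ae (ae_restrict_of_ae hff')
  have hf' : LocallyIntegrable f' volume := by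
    intro x
    obtain ⟨S, hS, hi⟩ := hf x
    exact ⟨S, hS, hi.congr (ae_restrict_of_ae hff')⟩
  have hb' : IsBMOWith f' M := by
    intro x r hr
    refine le_trans (le_of_eq ?_) (hb x r hr)
    congr 1
    apply integral_congr_ae
    filter_upwards [ae_restrict_of_ae hff'] with y hy
    rw [hy, havg]
  simp only [hheat] at hfin ⊢
  exact h f' M hf'm.measurable hf' hb' hfin x₀ r₀ hr₀

end
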